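/- For every matroid M with finite ground set E and rank r+1, the f-vector of the broken circuit complex of M is unimodal: there exists an index k₀ with 0 ≤ k₀ ≤ r+1 such that f_0 ≤ f_1 ≤ … ≤ f_{k₀} and f_{k₀} ≥ f_{k₀+1} ≥ … ≥ f_{r+1}. -/

import Mathlib

open Polynomial

/-- The rank of a set `X` in a matroid `M`: the supremum of the cardinalities of the
independent subsets of `X`. -/
noncomputable def matroidRank {α : Type*} (M : Matroid α) (X : Set α) : ℕ :=
  sSup {m | ∃ I ⊆ X, M.Indep I ∧ I.ncard = m}

/-- The characteristic polynomial of a matroid `M` of rank `r + 1` whose ground set is a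
finite type `α` :  `χ_M(q) = Σ_{S ⊆ E} (−1)^{|S|} q^{(r+1) − rk(S)}`. -/
noncomputable def matroidCharPoly {α : Type*} [Fintype α] (M : Matroid α) (r : ℕ) :
    Polynomial ℤ :=
  ∑ S : Finset α, (-1 : Polynomial ℤ) ^ S.card * X ^ (r + 1 - matroidRank M ↑S)

namespace FlagDegree

/-- Let `A` be a symmetric matrix with nonnegative off-diagonal entries and connected support,
with `A v = w` for positive vectors `v` and `w`. If `A` is dominated by `A D⁻¹ A`, where `D` is the
diagonal matrix with entries `w i / v i`, then the quadratic form of `A` is nonpositive on the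
hyperplane orthogonal to `w`. -/
theorem quadForm_nonpos_of_perron {ι : Type*} [Fintype ι] [DecidableEq ι]
    (A : ι → ι → ℝ) (hsymm : ∀ i j, A i j = A j i) (hoff : ∀ i j, i ≠ j → 0 ≤ A i j)
    (v w : ι → ℝ) (hv : ∀ i, 0 < v i) (hw : ∀ i, 0 < w i) (hAv : ∀ i, ∑ j, A i j * v j = w i)
    (hconn : ∀ i j, Relation.ReflTransGen (fun i j => 0 < A i j) i j)
    (hsq : ∀ x : ι → ℝ, ∑ i, ∑ j, A i j * x i * x j ≤ ∑ i, v i / w i * (∑ j, A i j * x j) ^ 2)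
    (x : ι → ℝ) (hx : ∑ i, w i * x i = 0) :
    ∑ i, ∑ j, A i j * x i * x j ≤ 0 := by
  set d : ι → ℝ := fun i => √(w i / v i) with hd
  have hdpos : ∀ i, 0 < d i := fun i => Real.sqrt_pos.2 (div_pos (hw i) (hv i))
  have hdsq : ∀ i, d i ^ 2 = w i / v i := fun i => Real.sq_sqrt (div_pos (hw i) (hv i)).le
  set S : Matrix ι ι ℝ := fun i j => A i j / (d i * d j) with hS
  have hH : S.IsHermitian := by
    refine Matrix.IsHermitian.ext fun i j => ?_
    simp [hS, hsymm i j, mul_comm]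
  have hquad : ∀ y : ι → ℝ, ∑ i, ∑ j, A i j * (y i / d i) * (y j / d j) =
      ∑ i, y i * (S.mulVec y) i := by
    intro y
    refine Finset.sum_congr rfl fun i _ => ?_
    simp only [Matrix.mulVec, dotProduct, Finset.mul_sum]
    refine Finset.sum_congr rfl fun j _ => ?_
    have := (hdpos i).ne'; have := (hdpos j).ne'
    simp only [hS]; field_simp
  have hsq' : ∀ y : ι → ℝ, ∑ i, y i * (S.mulVec y) i ≤ ∑ i, (S.mulVec y) i ^ 2 := by
    intro y
    rw [← hquad]
    refine (hsq fun i => y i / d i).trans (le_of_eq ?_)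
    refine Finset.sum_congr rfl fun i _ => ?_
    have h1 : S.mulVec y i = (∑ j, A i j * (y j / d j)) / d i := by
      simp only [Matrix.mulVec, dotProduct, Finset.sum_div]
      refine Finset.sum_congr rfl fun j _ => ?_
      have := (hdpos i).ne'; have := (hdpos j).ne'
      simp only [hS]; field_simp
    rw [h1, div_pow, hdsq]
    have := (hv i).ne'; have := (hw i).ne'
    field_simp
  -- the Dirichlet form
  have hdir : ∀ y : ι → ℝ, 2 * (∑ i, y i ^ 2 - ∑ i, y i * (S.mulVec y) i) =
      ∑ i, ∑ j, A i j * v i * v j * (y i / d i / v i - y j / d j / v j) ^ 2 := by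
    intro y
    have e1 : ∀ i, ∑ j, A i j * v i * v j * (y i / d i / v i) ^ 2 = y i ^ 2 := by
      intro i
      have : ∑ j, A i j * v i * v j * (y i / d i / v i) ^ 2 =
          (∑ j, A i j * v j) * (v i * (y i / d i / v i) ^ 2) := by
        rw [Finset.sum_mul]; exact Finset.sum_congr rfl fun j _ => by ring
      rw [this, hAv, div_pow, div_pow, hdsq]
      have := (hv i).ne'; have := (hw i).ne'
      field_simp
    have e2 : ∑ i, ∑ j, A i j * v i * v j * (y j / d j / v j) ^ 2 = ∑ i, y i ^ 2 := by
      rw [Finset.sum_comm]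
      refine Finset.sum_congr rfl fun j _ => ?_
      rw [← e1 j]
      exact Finset.sum_congr rfl fun i _ => by rw [hsymm i j]; ring
    have e3 : ∑ i, ∑ j, A i j * v i * v j * (y i / d i / v i * (y j / d j / v j)) =
        ∑ i, y i * (S.mulVec y) i := by
      rw [← hquad]
      refine Finset.sum_congr rfl fun i _ => Finset.sum_congr rfl fun j _ => ?_
      have := (hv i).ne'; have := (hv j).ne'
      field_simp
    have e4 : ∑ i, ∑ j, A i j * v i * v j * (y i / d i / v i - y j / d j / v j) ^ 2 =
        ∑ i, ∑ j, A i j * v i * v j * (y i / d i / v i) ^ 2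
        + ∑ i, ∑ j, A i j * v i * v j * (y j / d j / v j) ^ 2
        - 2 * ∑ i, ∑ j, A i j * v i * v j * (y i / d i / v i * (y j / d j / v j)) := by
      rw [Finset.mul_sum, ← Finset.sum_add_distrib, ← Finset.sum_sub_distrib]
      refine Finset.sum_congr rfl fun i _ => ?_
      rw [Finset.mul_sum, ← Finset.sum_add_distrib, ← Finset.sum_sub_distrib]
      exact Finset.sum_congr rfl fun j _ => by ring
    rw [e4, e2, e3, Finset.sum_congr rfl fun i _ => e1 i]
    ring
  have hterm : ∀ (y : ι → ℝ) i j,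
      0 ≤ A i j * v i * v j * (y i / d i / v i - y j / d j / v j) ^ 2 := by
    intro y i j
    by_cases hij : i = j
    · subst hij; simp
    · have := hoff i j hij
      have := hv i; have := hv j
      positivity
  set b := hH.eigenvectorBasis with hb
  set ev := hH.eigenvalues with hev
  have hmul : ∀ k, S.mulVec (b k).ofLp = ev k • (b k).ofLp := fun k => hH.mulVec_eigenvectorBasis k
  have hnorm : ∀ k, ∑ i, (b k).ofLp i ^ 2 = 1 := by
    intro k
    have := b.orthonormal.1 k
    rw [EuclideanSpace.norm_eq, Real.sqrt_eq_one] at this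
    simpa using this
  set y : EuclideanSpace ℝ ι := WithLp.toLp 2 (fun i => d i * x i) with hy
  have key : ∀ k, 0 < ev k → inner ℝ (b k) y = 0 := by
    intro k hk
    have e1 : ∑ i, (b k).ofLp i * (S.mulVec (b k).ofLp) i = ev k := by
      rw [hmul]
      calc _ = ev k * ∑ i, (b k).ofLp i ^ 2 := by
            rw [Finset.mul_sum]; exact Finset.sum_congr rfl fun i _ => by simp; ring
        _ = ev k := by rw [hnorm, mul_one]
    have e2 : ∑ i, (S.mulVec (b k).ofLp) i ^ 2 = ev k ^ 2 := by
      rw [hmul]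
      calc _ = ev k ^ 2 * ∑ i, (b k).ofLp i ^ 2 := by
            rw [Finset.mul_sum]; exact Finset.sum_congr rfl fun i _ => by simp; ring
        _ = ev k ^ 2 := by rw [hnorm, mul_one]
    have e3 := hsq' (b k).ofLp
    rw [e1, e2] at e3
    have h1 : 1 ≤ ev k := by nlinarith
    have e4 := hdir (b k).ofLp
    rw [e1, hnorm] at e4
    have hzero : ∑ i, ∑ j, A i j * v i * v j *
        ((b k).ofLp i / d i / v i - (b k).ofLp j / d j / v j) ^ 2 = 0 :=
      le_antisymm (by rw [← e4]; linarith)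
        (Finset.sum_nonneg fun i _ => Finset.sum_nonneg fun j _ => hterm _ i j)
    have hedge : ∀ i j, 0 < A i j →
        (b k).ofLp i / d i / v i = (b k).ofLp j / d j / v j := by
      intro i j hij
      have h2 := (Finset.sum_eq_zero_iff_of_nonneg fun i _ =>
        Finset.sum_nonneg fun j _ => hterm _ i j).1 hzero i (Finset.mem_univ i)
      have h3 := (Finset.sum_eq_zero_iff_of_nonneg fun j _ => hterm _ i j).1 h2 j
        (Finset.mem_univ j)
      have := hv i; have := hv j
      have h4 : A i j * v i * v j ≠ 0 := by positivity
      have := (mul_eq_zero.1 h3).resolve_left h4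
      exact sub_eq_zero.1 (pow_eq_zero_iff two_ne_zero |>.1 this)
    have hconst : ∀ i j, (b k).ofLp i / d i / v i = (b k).ofLp j / d j / v j := by
      intro i j
      induction hconn i j with
      | refl => rfl
      | tail _ h ih => exact ih.trans (hedge _ _ h)
    rcases isEmpty_or_nonempty ι with hι | ⟨⟨i₀⟩⟩
    · simp [PiLp.inner_apply]
    · have : inner ℝ (b k) y = ((b k).ofLp i₀ / d i₀ / v i₀) * ∑ i, w i * x i := by
        rw [PiLp.inner_apply, Finset.mul_sum]
        refine Finset.sum_congr rfl fun i _ => ?_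
        rw [hconst i₀ i]
        have h5 := hdsq i
        have := (hv i).ne'; have := (hdpos i).ne'
        have h6 : w i = d i ^ 2 * v i := by rw [h5]; field_simp
        rw [h6]
        simp [hy]
        field_simp
      rw [this, hx, mul_zero]
  have hfin : ∑ i, ∑ j, A i j * x i * x j = ∑ k, ev k * (inner ℝ (b k) y) ^ 2 := by
    have h1 : ∑ i, ∑ j, A i j * x i * x j = ∑ i, y.ofLp i * (S.mulVec y.ofLp) i := by
      rw [← hquad]
      refine Finset.sum_congr rfl fun i _ => Finset.sum_congr rfl fun j _ => ?_
      have := (hdpos i).ne'; have := (hdpos j).ne'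
      simp [hy]; field_simp
    have h2 : ∑ i, y.ofLp i * (S.mulVec y.ofLp) i =
        inner ℝ y (WithLp.toLp 2 (S.mulVec y.ofLp)) := by
      rw [PiLp.inner_apply]
      exact Finset.sum_congr rfl fun i _ => by simp [mul_comm]
    rw [h1, h2, ← b.sum_inner_mul_inner]
    refine Finset.sum_congr rfl fun k _ => ?_
    have h3 : inner ℝ (b k) (WithLp.toLp 2 (S.mulVec y.ofLp)) = ev k * inner ℝ (b k) y := by
      have : inner ℝ (b k) (WithLp.toLp 2 (S.mulVec y.ofLp)) =
          (S.mulVec y.ofLp) ⬝ᵥ (b k).ofLp := by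
        rw [PiLp.inner_apply]
        exact Finset.sum_congr rfl fun i _ => by simp
      rw [this, dotProduct_comm, Matrix.dotProduct_mulVec, ← Matrix.mulVec_transpose,
        show S.transpose = S from by simpa using hH.eq, hmul, smul_dotProduct, PiLp.inner_apply]
      simp only [smul_eq_mul, dotProduct]
      congr 1
      exact Finset.sum_congr rfl fun i _ => by simp [mul_comm]
    rw [h3, real_inner_comm]
    ring
  rw [hfin]
  refine Finset.sum_nonpos fun k _ => ?_
  by_cases hk : 0 < ev k
  · rw [key k hk]; simp
  · exact mul_nonpos_of_nonpos_of_nonneg (not_lt.1 hk) (sq_nonneg _)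


/-! ### Flags in a finite bounded order -/

section Flags

set_option linter.unusedSectionVars false

open scoped Classical

variable {L : Type*} [PartialOrder L] [BoundedOrder L] [Fintype L]

/-- A flag: a chain containing the bottom and the top element. -/
structure IsFlag (σ : Finset L) : Prop where
  bot_mem : ⊥ ∈ σ
  top_mem : ⊤ ∈ σ
  total : ∀ A ∈ σ, ∀ B ∈ σ, A < B ∨ A = B ∨ B < A

/-- The elements by which a flag can be refined. -/
noncomputable def link (σ : Finset L) : Finset L :=
  Finset.univ.filter fun F => ∀ A ∈ σ, A < F ∨ F < A

/-- The largest element of `σ` below `F`. -/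
noncomputable def lower (σ : Finset L) (F : L) : L :=
  if h : ∃ A ∈ σ, A < F ∧ ∀ H ∈ σ, H < F → H ≤ A then h.choose else ⊥

/-- The smallest element of `σ` above `F`. -/
noncomputable def upper (σ : Finset L) (F : L) : L :=
  if h : ∃ A ∈ σ, F < A ∧ ∀ H ∈ σ, F < H → A ≤ H then h.choose else ⊤

variable {σ : Finset L} {F G A B : L}

theorem mem_link : F ∈ link σ ↔ ∀ A ∈ σ, A < F ∨ F < A := by simp [link]

theorem not_mem_of_mem_link (h : F ∈ link σ) : F ∉ σ := fun hF => by
  simpa using mem_link.1 h F hF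

theorem mem_link_insert : G ∈ link (insert F σ) ↔ (F < G ∨ G < F) ∧ G ∈ link σ := by
  simp [mem_link]

theorem IsFlag.insert (hσ : IsFlag σ) (hF : F ∈ link σ) : IsFlag (insert F σ) where
  bot_mem := Finset.mem_insert_of_mem hσ.bot_mem
  top_mem := Finset.mem_insert_of_mem hσ.top_mem
  total := by
    have h := mem_link.1 hF
    intro A hA B hB
    rcases Finset.mem_insert.1 hA with rfl | hA' <;> rcases Finset.mem_insert.1 hB with rfl | hB'
    · exact .inr (.inl rfl)
    · rcases h B hB' with h | h
      · exact .inr (.inr h)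
      · exact .inl h
    · rcases h A hA' with h | h
      · exact .inl h
      · exact .inr (.inr h)
    · exact hσ.total A hA' B hB'

theorem card_insert_of_mem_link (hF : F ∈ link σ) : (insert F σ).card = σ.card + 1 :=
  Finset.card_insert_of_notMem (not_mem_of_mem_link hF)

theorem IsFlag.bot_lt (hσ : IsFlag σ) (hF : F ∈ link σ) : ⊥ < F :=
  (mem_link.1 hF _ hσ.bot_mem).resolve_right not_lt_bot

theorem IsFlag.lt_top (hσ : IsFlag σ) (hF : F ∈ link σ) : F < ⊤ :=
  (mem_link.1 hF _ hσ.top_mem).resolve_left not_top_lt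

theorem IsFlag.lower_spec (hσ : IsFlag σ) (hF : F ∈ link σ) :
    lower σ F ∈ σ ∧ lower σ F < F ∧ ∀ H ∈ σ, H < F → H ≤ lower σ F := by
  have h : ∃ A ∈ σ, A < F ∧ ∀ H ∈ σ, H < F → H ≤ A := by
    obtain ⟨A, hA⟩ := (σ.filter (· < F)).exists_maximal
      ⟨⊥, Finset.mem_filter.2 ⟨hσ.bot_mem, hσ.bot_lt hF⟩⟩
    have hA' := Finset.mem_filter.1 hA.1
    refine ⟨A, hA'.1, hA'.2, fun H hH hHF => ?_⟩
    rcases hσ.total H hH A hA'.1 with h | h | h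
    · exact h.le
    · exact h.le
    · exact hA.2 (Finset.mem_filter.2 ⟨hH, hHF⟩) h.le
  rw [lower, dif_pos h]
  exact h.choose_spec

theorem IsFlag.upper_spec (hσ : IsFlag σ) (hF : F ∈ link σ) :
    upper σ F ∈ σ ∧ F < upper σ F ∧ ∀ H ∈ σ, F < H → upper σ F ≤ H := by
  have h : ∃ A ∈ σ, F < A ∧ ∀ H ∈ σ, F < H → A ≤ H := by
    obtain ⟨A, hA⟩ := (σ.filter (F < ·)).exists_minimal
      ⟨⊤, Finset.mem_filter.2 ⟨hσ.top_mem, hσ.lt_top hF⟩⟩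
    have hA' := Finset.mem_filter.1 hA.1
    refine ⟨A, hA'.1, hA'.2, fun H hH hHF => ?_⟩
    rcases hσ.total H hH A hA'.1 with h | h | h
    · exact hA.2 (Finset.mem_filter.2 ⟨hH, hHF⟩) h.le
    · exact h.ge
    · exact h.le
  rw [upper, dif_pos h]
  exact h.choose_spec

theorem lower_eq (hA : A ∈ σ) (hAF : A < F) (h : ∀ H ∈ σ, H < F → H ≤ A) : lower σ F = A := by
  have h' : ∃ A ∈ σ, A < F ∧ ∀ H ∈ σ, H < F → H ≤ A := ⟨A, hA, hAF, h⟩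
  rw [lower, dif_pos h']
  obtain ⟨h1, h2, h3⟩ := h'.choose_spec
  exact le_antisymm (h _ h1 h2) (h3 _ hA hAF)

theorem upper_eq (hA : A ∈ σ) (hAF : F < A) (h : ∀ H ∈ σ, F < H → A ≤ H) : upper σ F = A := by
  have h' : ∃ A ∈ σ, F < A ∧ ∀ H ∈ σ, F < H → A ≤ H := ⟨A, hA, hAF, h⟩
  rw [upper, dif_pos h']
  obtain ⟨h1, h2, h3⟩ := h'.choose_spec
  exact le_antisymm (h3 _ hA hAF) (h _ h1 h2)

/-- Elements of the link lying in the same gap have the same neighbours. -/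
theorem IsFlag.lower_eq_of_gap (hσ : IsFlag σ) (hF : F ∈ link σ)
    (h1 : lower σ F < G) (h2 : G < upper σ F) : lower σ G = lower σ F := by
  obtain ⟨a1, a2, a3⟩ := hσ.lower_spec hF
  obtain ⟨b1, b2, b3⟩ := hσ.upper_spec hF
  refine lower_eq a1 h1 fun H hH hHG => ?_
  rcases mem_link.1 hF H hH with h | h
  · exact a3 H hH h
  · exact absurd ((b3 H hH h).trans_lt hHG) h2.not_gt

theorem IsFlag.upper_eq_of_gap (hσ : IsFlag σ) (hF : F ∈ link σ)
    (h1 : lower σ F < G) (h2 : G < upper σ F) : upper σ G = upper σ F := by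
  obtain ⟨a1, a2, a3⟩ := hσ.lower_spec hF
  obtain ⟨b1, b2, b3⟩ := hσ.upper_spec hF
  refine upper_eq b1 h2 fun H hH hHG => ?_
  rcases mem_link.1 hF H hH with h | h
  · exact absurd (hHG.trans_le (a3 H hH h)) h1.not_gt
  · exact b3 H hH h

/-- Two elements of the link either lie in the same gap or are separated by the flag. -/
theorem IsFlag.gap_cases (hσ : IsFlag σ) (hF : F ∈ link σ) (hG : G ∈ link σ) :
    (lower σ F < G ∧ G < upper σ F) ∨ (G < lower σ F) ∨ (upper σ F < G) := by
  rcases mem_link.1 hG _ (hσ.lower_spec hF).1 with h1 | h1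
  · rcases mem_link.1 hG _ (hσ.upper_spec hF).1 with h2 | h2
    · exact .inr (.inr h2)
    · exact .inl ⟨h1, h2⟩
  · exact .inr (.inl h1)

/-- The value at `F` of `u`, corrected by the interpolation of `u` between `A` and `B` that is
affine in the weight. -/
noncomputable def interpDefect (w : L → ℝ) (A B : L) (u : L → ℝ) (F : L) : ℝ :=
  u F - (u A * (w B - w F) + u B * (w F - w A)) / (w B - w A)

/-- The normalisation of `u` with respect to a flag. -/
noncomputable def normalize (w : L → ℝ) (σ : Finset L) (u : L → ℝ) (F : L) : ℝ :=
  interpDefect w (lower σ F) (upper σ F) u F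

variable {w : L → ℝ}

theorem normalize_insert_above (hw : StrictMono w) (hσ : IsFlag σ) (hF : F ∈ link σ)
    (hG : G ∈ link σ) (hFG : F < G) (hGB : G < upper σ F) (u : L → ℝ) :
    normalize w (insert F σ) u G = normalize w σ u G -
      (w (upper σ F) - w G) / (w (upper σ F) - w F) * normalize w σ u F := by
  obtain ⟨a1, a2, a3⟩ := hσ.lower_spec hF
  obtain ⟨b1, b2, b3⟩ := hσ.upper_spec hF
  have e1 := hσ.lower_eq_of_gap hF (a2.trans hFG) hGB
  have e2 := hσ.upper_eq_of_gap hF (a2.trans hFG) hGB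
  have e3 : lower (insert F σ) G = F := by
    refine lower_eq (Finset.mem_insert_self _ _) hFG fun H hH hHG => ?_
    rcases Finset.mem_insert.1 hH with rfl | hH
    · exact le_rfl
    · exact ((hσ.lower_spec hG).2.2 H hH hHG).trans (e1 ▸ a2.le)
  have e4 : upper (insert F σ) G = upper σ F := by
    refine upper_eq (Finset.mem_insert_of_mem b1) hGB fun H hH hHG => ?_
    rcases Finset.mem_insert.1 hH with rfl | hH
    · exact absurd hHG hFG.not_gt
    · exact b3 H hH (hFG.trans hHG)
  simp only [normalize, interpDefect, e1, e2, e3, e4]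
  have h1 : w (upper σ F) - w (lower σ F) ≠ 0 := (sub_pos.2 (hw (a2.trans b2))).ne'
  have h2 : w (upper σ F) - w F ≠ 0 := (sub_pos.2 (hw b2)).ne'
  field_simp
  ring

theorem normalize_insert_below (hw : StrictMono w) (hσ : IsFlag σ) (hF : F ∈ link σ)
    (hG : G ∈ link σ) (hFG : G < F) (hGB : lower σ F < G) (u : L → ℝ) :
    normalize w (insert F σ) u G = normalize w σ u G -
      (w G - w (lower σ F)) / (w F - w (lower σ F)) * normalize w σ u F := by
  obtain ⟨a1, a2, a3⟩ := hσ.lower_spec hF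
  obtain ⟨b1, b2, b3⟩ := hσ.upper_spec hF
  have e1 := hσ.lower_eq_of_gap hF hGB (hFG.trans b2)
  have e2 := hσ.upper_eq_of_gap hF hGB (hFG.trans b2)
  have e3 : upper (insert F σ) G = F := by
    refine upper_eq (Finset.mem_insert_self _ _) hFG fun H hH hHG => ?_
    rcases Finset.mem_insert.1 hH with rfl | hH
    · exact le_rfl
    · exact le_trans (e2 ▸ b2.le) ((hσ.upper_spec hG).2.2 H hH hHG)
  have e4 : lower (insert F σ) G = lower σ F := by
    refine lower_eq (Finset.mem_insert_of_mem a1) hGB fun H hH hHG => ?_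
    rcases Finset.mem_insert.1 hH with rfl | hH
    · exact absurd hHG hFG.not_gt
    · exact a3 H hH (hHG.trans hFG)
  simp only [normalize, interpDefect, e1, e2, e3, e4]
  have h1 : w (upper σ F) - w (lower σ F) ≠ 0 := (sub_pos.2 (hw (a2.trans b2))).ne'
  have h2 : w F - w (lower σ F) ≠ 0 := (sub_pos.2 (hw a2)).ne'
  field_simp
  ring

theorem normalize_insert_of_separated (hσ : IsFlag σ) (hF : F ∈ link σ)
    (hG : G ∈ link σ) (h : G < lower σ F ∨ upper σ F < G) (u : L → ℝ) :
    normalize w (insert F σ) u G = normalize w σ u G := by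
  obtain ⟨a1, a2, a3⟩ := hσ.lower_spec hF
  obtain ⟨b1, b2, b3⟩ := hσ.upper_spec hF
  obtain ⟨c1, c2, c3⟩ := hσ.lower_spec hG
  obtain ⟨d1, d2, d3⟩ := hσ.upper_spec hG
  have e3 : lower (insert F σ) G = lower σ G := by
    refine lower_eq (Finset.mem_insert_of_mem c1) c2 fun H hH hHG => ?_
    rcases Finset.mem_insert.1 hH with rfl | hH
    · rcases h with h | h
      · exact absurd (hHG.trans h) a2.not_gt
      · exact b2.le.trans (c3 _ b1 h)
    · exact c3 H hH hHG
  have e4 : upper (insert F σ) G = upper σ G := by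
    refine upper_eq (Finset.mem_insert_of_mem d1) d2 fun H hH hHG => ?_
    rcases Finset.mem_insert.1 hH with rfl | hH
    · rcases h with h | h
      · exact (d3 _ a1 h).trans a2.le
      · exact absurd (h.trans hHG) b2.not_gt
    · exact d3 H hH hHG
  simp only [normalize, e3, e4]

theorem exists_normalize_insert (hw : StrictMono w) (hσ : IsFlag σ) (hF : F ∈ link σ)
    (hG : G ∈ link (insert F σ)) : ∃ c : ℝ, ∀ u,
      normalize w (insert F σ) u G = normalize w σ u G - c * normalize w σ u F := by
  obtain ⟨hFG, hG⟩ := mem_link_insert.1 hG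
  rcases hσ.gap_cases hF hG with ⟨h1, h2⟩ | h
  · rcases hFG with h | h
    · exact ⟨_, normalize_insert_above hw hσ hF hG h h2⟩
    · exact ⟨_, normalize_insert_below hw hσ hF hG h h1⟩
  · exact ⟨0, fun u => by rw [normalize_insert_of_separated hσ hF hG h, zero_mul, sub_zero]⟩

theorem normalize_linear (σ : Finset L) (a b : ℝ) (x y : L → ℝ) (F : L) :
    normalize w σ (a • x + b • y) F = a * normalize w σ x F + b * normalize w σ y F := by
  simp only [normalize, interpDefect, Pi.add_apply, Pi.smul_apply, smul_eq_mul]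
  ring

theorem normalize_of_eq_zero (hσ : IsFlag σ) (hF : F ∈ link σ) {u : L → ℝ}
    (hu : ∀ A ∈ σ, u A = 0) : normalize w σ u F = u F := by
  simp [normalize, interpDefect, hu _ (hσ.lower_spec hF).1, hu _ (hσ.upper_spec hF).1]

/-! ### The mixed degree -/

/-- The mixed degree of a list of divisors on the star of a flag. -/
noncomputable def mixedDegree (w : L → ℝ) : List (L → ℝ) → Finset L → ℝ
  | [], _ => 1
  | u :: us, σ => ∑ F ∈ link σ, normalize w σ u F * mixedDegree w us (insert F σ)

theorem mixedDegree_cons (u : L → ℝ) (us : List (L → ℝ)) (σ : Finset L) :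
    mixedDegree w (u :: us) σ =
      ∑ F ∈ link σ, normalize w σ u F * mixedDegree w us (insert F σ) := rfl

theorem mixedDegree_swap (hw : StrictMono w) (hσ : IsFlag σ) (u v : L → ℝ)
    (us : List (L → ℝ)) :
    mixedDegree w (u :: v :: us) σ = mixedDegree w (v :: u :: us) σ := by
  have hc : ∀ F G, ∃ c : ℝ, F ∈ link σ → G ∈ link (insert F σ) → ∀ u,
      normalize w (insert F σ) u G = normalize w σ u G - c * normalize w σ u F := by
    intro F G
    by_cases h : F ∈ link σ ∧ G ∈ link (insert F σ)
    · obtain ⟨c, hc⟩ := exists_normalize_insert hw hσ h.1 h.2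
      exact ⟨c, fun _ _ => hc⟩
    · exact ⟨0, fun h1 h2 => absurd ⟨h1, h2⟩ h⟩
  choose c hc using hc
  have key : ∀ u v, mixedDegree w (u :: v :: us) σ =
      ∑ F ∈ link σ, ∑ G ∈ link (insert F σ), normalize w σ u F * normalize w σ v G *
        mixedDegree w us (insert G (insert F σ)) -
      ∑ F ∈ link σ, ∑ G ∈ link (insert F σ), normalize w σ u F * normalize w σ v F * c F G *
        mixedDegree w us (insert G (insert F σ)) := by
    intro u v
    rw [mixedDegree_cons, ← Finset.sum_sub_distrib]
    refine Finset.sum_congr rfl fun F hF => ?_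
    rw [mixedDegree_cons, Finset.mul_sum, ← Finset.sum_sub_distrib]
    refine Finset.sum_congr rfl fun G hG => ?_
    rw [hc F G hF hG]
    ring
  rw [key, key]
  congr 1
  · rw [Finset.sum_comm' (t' := link σ) (s' := fun G => link (insert G σ))]
    · refine Finset.sum_congr rfl fun F _ => Finset.sum_congr rfl fun G _ => ?_
      rw [Finset.insert_comm]
      ring
    · intro F G
      simp only [mem_link_insert]
      tauto
  · refine Finset.sum_congr rfl fun F _ => Finset.sum_congr rfl fun G _ => ?_
    ring

theorem mixedDegree_congr_tail {us vs : List (L → ℝ)}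
    (h : ∀ τ : Finset L, IsFlag τ → mixedDegree w us τ = mixedDegree w vs τ) (hσ : IsFlag σ)
    (u : L → ℝ) : mixedDegree w (u :: us) σ = mixedDegree w (u :: vs) σ := by
  rw [mixedDegree_cons, mixedDegree_cons]
  exact Finset.sum_congr rfl fun F hF => by rw [h _ (hσ.insert hF)]

theorem mixedDegree_perm (hw : StrictMono w) {us vs : List (L → ℝ)} (h : us.Perm vs) :
    ∀ σ : Finset L, IsFlag σ → mixedDegree w us σ = mixedDegree w vs σ := by
  induction h with
  | nil => intro σ _; rfl
  | cons u _ ih => intro σ hσ; exact mixedDegree_congr_tail ih hσ u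
  | swap u v us => intro σ hσ; exact mixedDegree_swap hw hσ _ _ _
  | trans _ _ ih1 ih2 => intro σ hσ; exact (ih1 σ hσ).trans (ih2 σ hσ)

theorem mixedDegree_linear (a b : ℝ) (x y : L → ℝ) (us : List (L → ℝ)) (σ : Finset L) :
    mixedDegree w ((a • x + b • y) :: us) σ =
      a * mixedDegree w (x :: us) σ + b * mixedDegree w (y :: us) σ := by
  simp only [mixedDegree_cons, normalize_linear, Finset.mul_sum, ← Finset.sum_add_distrib]
  exact Finset.sum_congr rfl fun F _ => by ring

theorem mixedDegree_quadratic (hw : StrictMono w) (hσ : IsFlag σ) (a b : ℝ) (x y : L → ℝ)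
    (us : List (L → ℝ)) :
    mixedDegree w ((a • x + b • y) :: (a • x + b • y) :: us) σ =
      a ^ 2 * mixedDegree w (x :: x :: us) σ + 2 * a * b * mixedDegree w (x :: y :: us) σ +
        b ^ 2 * mixedDegree w (y :: y :: us) σ := by
  rw [mixedDegree_linear, mixedDegree_swap hw hσ x, mixedDegree_swap hw hσ y,
    mixedDegree_linear, mixedDegree_linear, mixedDegree_swap hw hσ y x]
  ring

/-! ### Geometric weights -/

/-- A rank function and a weight turning a bounded order into something like the order of flats
of a loopless matroid, weighted by cardinality. -/
structure IsGeometric (rk : L → ℕ) (w : L → ℝ) : Prop where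
  strictMono : StrictMono w
  weight_bot : w (⊥ : L) = 0
  rk_bot : rk (⊥ : L) = 0
  rk_covBy : ∀ A B : L, A ⋖ B → rk B = rk A + 1
  sum_covBy : ∀ A B : L, A < B → ∑ H : L with A ⋖ H ∧ H ≤ B, (w H - w A) = w B - w A
  exists_join : ∀ A F G : L, A ⋖ F → A ⋖ G → F ≠ G →
    ∃ H, F ⋖ H ∧ G ⋖ H ∧ ∀ B, F ≤ B → G ≤ B → H ≤ B

variable {rk : L → ℕ}

theorem exists_covBy_le (h : A < B) : ∃ H, A ⋖ H ∧ H ≤ B := by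
  obtain ⟨H, hH⟩ := (Finset.univ.filter fun H => A < H ∧ H ≤ B).exists_minimal
    ⟨B, by simp [h]⟩
  have h1 := (Finset.mem_filter.1 hH.1).2
  refine ⟨H, ⟨h1.1, fun K hK hKH => ?_⟩, h1.2⟩
  exact hKH.not_ge (hH.2 (Finset.mem_filter.2 ⟨Finset.mem_univ _, hK, hKH.le.trans h1.2⟩) hKH.le)

namespace IsGeometric

theorem rk_strictMono (hg : IsGeometric rk w) : StrictMono rk := by
  intro A B
  induction A using WellFoundedGT.induction with
  | ind A ih =>
    intro h
    obtain ⟨H, h1, h2⟩ := exists_covBy_le h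
    have h3 := hg.rk_covBy _ _ h1
    rcases h2.eq_or_lt with rfl | h2
    · omega
    · have := ih H h1.lt h2
      omega

theorem covBy_of_lt (hg : IsGeometric rk w) (h : A < B) (hrk : rk B ≤ rk A + 1) : A ⋖ B :=
  ⟨h, fun H h1 h2 => by
    have := hg.rk_strictMono h1
    have := hg.rk_strictMono h2
    omega⟩

theorem eq_of_le (hg : IsGeometric rk w) (h : A ≤ B) (hrk : rk B ≤ rk A) : A = B := by
  rcases h.eq_or_lt with h | h
  · exact h
  · exact absurd (hg.rk_strictMono h) hrk.not_gt

theorem lt_of_rk_lt (hg : IsGeometric rk w) (hσ : IsFlag σ) (hA : A ∈ σ) (hB : B ∈ σ)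
    (h : rk A < rk B) : A < B := by
  rcases hσ.total A hA B hB with h1 | rfl | h1
  · exact h1
  · omega
  · have := hg.rk_strictMono h1
    omega

theorem lt_of_rk_lt_of_mem_link (hg : IsGeometric rk w) (hF : F ∈ link σ) (hA : A ∈ σ)
    (h : rk A < rk F) : A < F :=
  (mem_link.1 hF A hA).resolve_right fun h1 => (hg.rk_strictMono h1).not_gt h

theorem lt_of_rk_lt_of_mem_link' (hg : IsGeometric rk w) (hF : F ∈ link σ) (hA : A ∈ σ)
    (h : rk F < rk A) : F < A :=
  (mem_link.1 hF A hA).resolve_left fun h1 => (hg.rk_strictMono h1).not_gt h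

theorem rk_ne_of_mem_link (hg : IsGeometric rk w) (hF : F ∈ link σ) (hA : A ∈ σ) :
    rk F ≠ rk A := by
  rcases mem_link.1 hF A hA with h | h
  · exact (hg.rk_strictMono h).ne'
  · exact (hg.rk_strictMono h).ne

theorem rk_le_top (hg : IsGeometric rk w) (A : L) : rk A ≤ rk ⊤ :=
  hg.rk_strictMono.monotone le_top

theorem card_image_rk (hg : IsGeometric rk w) (hσ : IsFlag σ) : (σ.image rk).card = σ.card := by
  refine Finset.card_image_of_injOn fun A hA B hB h => ?_
  rcases hσ.total A hA B hB with h1 | h1 | h1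
  · exact absurd h (hg.rk_strictMono h1).ne
  · exact h1
  · exact absurd h (hg.rk_strictMono h1).ne.symm

/-- The ranks missed by a flag. -/
theorem card_missing (hg : IsGeometric rk w) (hσ : IsFlag σ) :
    (Finset.range (rk (⊤ : L) + 1) \ σ.image rk).card + σ.card = rk (⊤ : L) + 1 := by
  rw [← hg.card_image_rk hσ, Finset.card_sdiff_add_card_eq_card, Finset.card_range]
  intro k hk
  obtain ⟨A, -, rfl⟩ := Finset.mem_image.1 hk
  exact Finset.mem_range.2 (Nat.lt_succ_of_le (hg.rk_le_top A))

theorem link_nonempty (hg : IsGeometric rk w) (hσ : IsFlag σ) (h : σ.card ≤ rk (⊤ : L)) :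
    (link σ).Nonempty := by
  have h1 := hg.card_missing hσ
  obtain ⟨k, hk⟩ : (Finset.range (rk (⊤ : L) + 1) \ σ.image rk).Nonempty := by
    rw [← Finset.card_pos]; omega
  simp only [Finset.mem_sdiff, Finset.mem_range, Finset.mem_image, not_exists, not_and] at hk
  obtain ⟨A, hA⟩ := (σ.filter (rk · < k)).exists_maximal ⟨⊥, by
    have := hk.2 ⊥ hσ.bot_mem
    simp only [Finset.mem_filter, hσ.bot_mem, true_and, hg.rk_bot] at this ⊢
    omega⟩
  obtain ⟨B, hB⟩ := (σ.filter (k < rk ·)).exists_minimal ⟨⊤, by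
    have := hk.2 ⊤ hσ.top_mem
    simp only [Finset.mem_filter, hσ.top_mem, true_and]
    omega⟩
  have hA1 := Finset.mem_filter.1 hA.1
  have hB1 := Finset.mem_filter.1 hB.1
  have hAB : A < B := hg.lt_of_rk_lt hσ hA1.1 hB1.1 (by omega)
  obtain ⟨F, hF, hFB⟩ := exists_covBy_le hAB
  have hF1 := hg.rk_covBy _ _ hF
  have hFB : F < B := hFB.lt_of_ne fun h => by subst h; omega
  refine ⟨F, mem_link.2 fun H hH => ?_⟩
  rcases lt_trichotomy (rk H) k with h2 | h2 | h2
  · refine .inl (lt_of_le_of_lt ?_ hF.lt)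
    rcases hσ.total H hH A hA1.1 with h | h | h
    · exact h.le
    · exact h.le
    · exact hA.2 (Finset.mem_filter.2 ⟨hH, h2⟩) h.le
  · exact absurd h2 (hk.2 H hH)
  · refine .inr (hFB.trans_le ?_)
    rcases hσ.total H hH B hB1.1 with h | h | h
    · exact hB.2 (Finset.mem_filter.2 ⟨hH, h2⟩) h.le
    · exact h.ge
    · exact h.le

/-- The comparability graph on the link of a flag missing at least two ranks is connected. -/
theorem link_connected (hg : IsGeometric rk w) (hσ : IsFlag σ) (h : σ.card + 1 ≤ rk (⊤ : L))
    (F G : {F // F ∈ link σ}) :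
    Relation.ReflTransGen (fun F G : {F // F ∈ link σ} => F.1 < G.1 ∨ G.1 < F.1) F G := by
  obtain ⟨F, hF⟩ := F
  obtain ⟨G, hG⟩ := G
  obtain ⟨a1, a2, a3⟩ := hσ.lower_spec hF
  obtain ⟨b1, b2, b3⟩ := hσ.upper_spec hF
  have hgap : ∀ H, lower σ F < H → H < upper σ F → H ∈ link σ := by
    intro H h1 h2
    refine mem_link.2 fun K hK => ?_
    rcases mem_link.1 hF K hK with h3 | h3
    · exact .inl ((a3 K hK h3).trans_lt h1)
    · exact .inr (h2.trans_le (b3 K hK h3))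
  set r := fun F G : {F // F ∈ link σ} => F.1 < G.1 ∨ G.1 < F.1
  have hup : ∀ A B (hA : A ∈ link σ) (hB : B ∈ link σ), A ≤ B →
      Relation.ReflTransGen r ⟨A, hA⟩ ⟨B, hB⟩ := by
    intro A B hA hB hAB
    rcases hAB.eq_or_lt with rfl | hAB
    · exact .refl
    · exact .single (.inl hAB)
  have hdown : ∀ A B (hA : A ∈ link σ) (hB : B ∈ link σ), A ≤ B →
      Relation.ReflTransGen r ⟨B, hB⟩ ⟨A, hA⟩ := by
    intro A B hA hB hAB
    rcases hAB.eq_or_lt with rfl | hAB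
    · exact .refl
    · exact .single (.inr hAB)
  rcases hσ.gap_cases hF hG with ⟨h1, h2⟩ | h1 | h1
  swap
  · exact .single (.inr (h1.trans a2))
  swap
  · exact .single (.inl (b2.trans h1))
  obtain ⟨F', hF', hFF'⟩ := exists_covBy_le a2
  obtain ⟨G', hG', hGG'⟩ := exists_covBy_le h1
  have hF'l := hgap F' hF'.lt (hFF'.trans_lt b2)
  have hG'l := hgap G' hG'.lt (hGG'.trans_lt h2)
  by_cases hne : F' = G'
  · subst hne
    exact (hdown _ _ hF'l hF hFF').trans (hup _ _ hF'l hG hGG')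
  obtain ⟨H, hH1, hH2, hH3⟩ := hg.exists_join _ _ _ hF' hG' hne
  have hHB := hH3 _ (hFF'.trans b2.le) (hGG'.trans h2.le)
  rcases hHB.eq_or_lt with hHB | hHB
  · have e1 := hg.rk_covBy _ _ hH1
    have e2 := hg.rk_covBy _ _ hF'
    obtain ⟨K, hK⟩ := hg.link_nonempty (hσ.insert hF) (by rw [card_insert_of_mem_link hF]; exact h)
    obtain ⟨hK1, hK2⟩ := mem_link_insert.1 hK
    have hKsep : K < lower σ F ∨ upper σ F < K := by
      refine (hσ.gap_cases hF hK2).resolve_left fun ⟨h3, h4⟩ => ?_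
      have := hg.rk_strictMono a2
      have := hg.rk_strictMono b2
      have := hg.rk_strictMono h3
      have := hg.rk_strictMono h4
      rw [hHB] at e1
      rcases hK1 with h5 | h5
      · have := hg.rk_strictMono h5
        omega
      · have := hg.rk_strictMono h5
        omega
    have s1 : r ⟨F, hF⟩ ⟨K, hK2⟩ := hK1
    have s2 : r ⟨K, hK2⟩ ⟨G, hG⟩ := by
      rcases hKsep with h3 | h3
      · exact .inl (h3.trans h1)
      · exact .inr (h2.trans h3)
    exact (Relation.ReflTransGen.single s1).tail s2
  · have hHl := hgap H (hF'.lt.trans hH1.lt) hHB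
    exact (((hdown _ _ hF'l hF hFF').trans (hup _ _ hF'l hHl hH1.le)).trans
      (hdown _ _ hG'l hHl hH2.le)).trans (hup _ _ hG'l hG hGG')

end IsGeometric

/-- Strict concavity with respect to the weight. -/
def IsConcave (w u : L → ℝ) : Prop := ∀ A B F, A < F → F < B → 0 < interpDefect w A B u F

theorem IsConcave.normalize_pos {u : L → ℝ} (hu : IsConcave w u) (hσ : IsFlag σ)
    (hF : F ∈ link σ) : 0 < normalize w σ u F :=
  hu _ _ _ (hσ.lower_spec hF).2.1 (hσ.upper_spec hF).2.1

theorem mixedDegree_pos (hg : IsGeometric rk w) {us : List (L → ℝ)}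
    (hus : ∀ u ∈ us, IsConcave w u) (hσ : IsFlag σ) (h : us.length + σ.card ≤ rk (⊤ : L) + 1) :
    0 < mixedDegree w us σ := by
  induction us generalizing σ with
  | nil => exact one_pos
  | cons u us ih =>
    rw [List.length_cons] at h
    refine Finset.sum_pos (fun F hF => ?_) (hg.link_nonempty hσ (by omega))
    refine mul_pos ((hus u (by simp)).normalize_pos hσ hF)
      (ih (fun u hu => hus u (by simp [hu])) (hσ.insert hF) ?_)
    rw [card_insert_of_mem_link hF]
    omega

/-- The reversed Cauchy–Schwarz inequality. -/
def IsLorentzian (Q : (L → ℝ) → (L → ℝ) → ℝ) : Prop :=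
  ∀ v x, 0 < Q v v → Q v v * Q x x ≤ Q v x ^ 2

theorem isLorentzian_of_le_sq {Q : (L → ℝ) → (L → ℝ) → ℝ}
    (hQ : ∀ (a b : ℝ) x y, Q (a • x + b • y) (a • x + b • y) =
      a ^ 2 * Q x x + 2 * a * b * Q x y + b ^ 2 * Q y y)
    {s : (L → ℝ) → ℝ} (hs : ∀ (a b : ℝ) x y, s (a • x + b • y) = a * s x + b * s y)
    {k : ℝ} (h : ∀ x, Q x x ≤ k * s x ^ 2) : IsLorentzian Q := by
  intro v x hv
  have h1 := h (s x • v + (-s v) • x)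
  rw [hQ, hs] at h1
  have hsv : s v ≠ 0 := by
    intro h0
    have := h v
    rw [h0] at this
    linarith [this]
  by_contra hlt
  push Not at hlt
  have h2 : 0 < s v ^ 2 := by positivity
  have h3 : 0 < Q v v * (s x ^ 2 * Q v v + 2 * s x * -s v * Q v x + (-s v) ^ 2 * Q x x) := by
    nlinarith [sq_nonneg (s x * Q v v - s v * Q v x), mul_pos h2 (sub_pos.2 hlt)]
  have h4 := pos_of_mul_pos_right h3 hv.le
  have : s x * s v + -s v * s x = 0 := by ring
  rw [this] at h1
  linarith

/-- The quadratic form of a list of divisors in normalised coordinates. -/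
theorem exists_mixedDegree_matrix (hw : StrictMono w) (hσ : IsFlag σ) (us : List (L → ℝ)) :
    ∃ A : L → L → ℝ, (∀ F G, A F G = A G F) ∧
      (∀ F G, F ≠ G → A F G = if F < G ∨ G < F then
        mixedDegree w us (insert G (insert F σ)) else 0) ∧
      ∀ F ∈ link σ, ∀ y, mixedDegree w (y :: us) (insert F σ) =
        ∑ G ∈ link σ, A F G * normalize w σ y G := by
  have hc : ∀ F G, ∃ c : ℝ, F ∈ link σ → G ∈ link (insert F σ) → ∀ u,
      normalize w (insert F σ) u G = normalize w σ u G - c * normalize w σ u F := by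
    intro F G
    by_cases h : F ∈ link σ ∧ G ∈ link (insert F σ)
    · obtain ⟨c, hc⟩ := exists_normalize_insert hw hσ h.1 h.2
      exact ⟨c, fun _ _ => hc⟩
    · exact ⟨0, fun h1 h2 => absurd ⟨h1, h2⟩ h⟩
  choose c hc using hc
  refine ⟨fun F G => if F = G then
      -∑ H ∈ link (insert F σ), c F H * mixedDegree w us (insert H (insert F σ)) else
      if F < G ∨ G < F then mixedDegree w us (insert G (insert F σ)) else 0, ?_, ?_, ?_⟩
  · intro F G
    by_cases h : F = G
    · subst h; rfl
    · simp only [h, Ne.symm h, if_false, Finset.insert_comm F G, or_comm]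
  · intro F G h
    simp [h]
  · intro F hF y
    have hlink : link (insert F σ) = (link σ).filter fun G => F < G ∨ G < F := by
      ext G
      rw [mem_link_insert, Finset.mem_filter, and_comm]
    have e1 : ∀ G ∈ link σ, (if F = G then
        -∑ H ∈ link (insert F σ), c F H * mixedDegree w us (insert H (insert F σ)) else
        if F < G ∨ G < F then mixedDegree w us (insert G (insert F σ)) else 0) *
          normalize w σ y G =
        (if F < G ∨ G < F then normalize w σ y G * mixedDegree w us (insert G (insert F σ))
          else 0) + (if F = G then
        -∑ H ∈ link (insert F σ), c F H * mixedDegree w us (insert H (insert F σ)) *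
          normalize w σ y F else 0) := by
      intro G _
      by_cases h : F = G
      · subst h; simp [Finset.sum_mul]
      · simp only [h, if_false, add_zero]
        split_ifs <;> ring
    rw [Finset.sum_congr rfl e1, Finset.sum_add_distrib, Finset.sum_ite_eq, if_pos hF,
      ← Finset.sum_filter, ← hlink, ← sub_eq_add_neg, ← Finset.sum_sub_distrib, mixedDegree_cons]
    refine Finset.sum_congr rfl fun G hG => ?_
    rw [hc F G hF hG]
    ring

/-- The inductive step of the Hodge–Riemann relations. -/
theorem isLorentzian_mixedDegree_cons (hg : IsGeometric rk w) (hσ : IsFlag σ) {u : L → ℝ}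
    {us : List (L → ℝ)} (hu : IsConcave w u) (hus : ∀ u ∈ us, IsConcave w u)
    (hcard : σ.card + us.length + 2 = rk (⊤ : L))
    (ih : ∀ F ∈ link σ, IsLorentzian fun x y => mixedDegree w (x :: y :: us) (insert F σ)) :
    IsLorentzian fun x y => mixedDegree w (x :: y :: u :: us) σ := by
  have hw := hg.strictMono
  obtain ⟨A, hsymm, hoff, hA⟩ := exists_mixedDegree_matrix hw hσ (u :: us)
  have hpos : ∀ F ∈ link σ, 0 < mixedDegree w (u :: u :: us) (insert F σ) := by
    intro F hF
    refine mixedDegree_pos hg (by simpa [hu] using hus) (hσ.insert hF) ?_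
    rw [card_insert_of_mem_link hF]
    simp only [List.length_cons]
    omega
  have hpos' : 0 < mixedDegree w (u :: u :: u :: us) σ := by
    refine mixedDegree_pos hg (by simpa [hu] using hus) hσ ?_
    simp only [List.length_cons]
    omega
  have hQ : ∀ x : L → ℝ, mixedDegree w (x :: x :: u :: us) σ =
      ∑ F : {F // F ∈ link σ}, ∑ G : {F // F ∈ link σ},
        A F G * normalize w σ x F * normalize w σ x G := by
    intro x
    rw [mixedDegree_cons, ← Finset.sum_coe_sort]
    refine Finset.sum_congr rfl fun F _ => ?_
    rw [hA F F.2, ← Finset.sum_coe_sort (link σ), Finset.mul_sum]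
    exact Finset.sum_congr rfl fun G _ => by ring
  have hneg : ∀ x : L → ℝ, mixedDegree w (x :: u :: u :: us) σ = 0 →
      mixedDegree w (x :: x :: u :: us) σ ≤ 0 := by
    intro x hx
    rw [hQ]
    refine quadForm_nonpos_of_perron (fun F G : {F // F ∈ link σ} => A F G)
      (fun F G => hsymm _ _) ?_ (fun F => normalize w σ u F)
      (fun F => mixedDegree w (u :: u :: us) (insert F.1 σ)) (fun F => hu.normalize_pos hσ F.2)
      (fun F => hpos F F.2) ?_ ?_ ?_ (fun F => normalize w σ x F) ?_
    · intro F G hFG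
      rw [hoff _ _ (Subtype.coe_ne_coe.2 hFG)]
      split_ifs with h
      · have hG : G.1 ∈ link (insert F.1 σ) := mem_link_insert.2 ⟨h, G.2⟩
        refine (mixedDegree_pos hg (by simpa [hu] using hus)
          ((hσ.insert F.2).insert hG) ?_).le
        rw [card_insert_of_mem_link hG, card_insert_of_mem_link F.2]
        simp only [List.length_cons]
        omega
      · exact le_rfl
    · intro F
      rw [hA F F.2, ← Finset.sum_coe_sort (link σ)]
    · intro F G
      refine Relation.ReflTransGen.mono (fun F G h => ?_) F G
        (hg.link_connected hσ (by omega) F G)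
      have hG : G.1 ∈ link (insert F.1 σ) := mem_link_insert.2 ⟨h, G.2⟩
      rw [hoff _ _ (by rcases h with h | h; exacts [h.ne, h.ne']), if_pos h]
      refine mixedDegree_pos hg (by simpa [hu] using hus) ((hσ.insert F.2).insert hG) ?_
      rw [card_insert_of_mem_link hG, card_insert_of_mem_link F.2]
      simp only [List.length_cons]
      omega
    · intro z
      set y : L → ℝ := fun F => if h : F ∈ link σ then z ⟨F, h⟩ else 0 with hy
      have hyz : ∀ F : {F // F ∈ link σ}, normalize w σ y F = z F := by
        intro F
        rw [normalize_of_eq_zero hσ F.2]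
        · simp [hy]
        · intro B hB
          rw [hy]
          exact dif_neg fun h => not_mem_of_mem_link h hB
      have e1 : ∑ F : {F // F ∈ link σ}, ∑ G : {F // F ∈ link σ}, A F G * z F * z G =
          ∑ F : {F // F ∈ link σ}, normalize w σ u F *
            mixedDegree w (y :: y :: us) (insert F.1 σ) := by
        have h1 := hQ y
        simp only [hyz] at h1
        rw [← h1, mixedDegree_perm hw (vs := u :: y :: y :: us) ?_ σ hσ, mixedDegree_cons,
          ← Finset.sum_coe_sort]
        exact ((List.Perm.swap _ _ _).cons _).trans (List.Perm.swap _ _ _)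
      rw [e1]
      refine Finset.sum_le_sum fun F _ => ?_
      have e2 : ∑ G : {F // F ∈ link σ}, A F G * z G =
          mixedDegree w (u :: y :: us) (insert F.1 σ) := by
        rw [mixedDegree_swap hw (hσ.insert F.2), hA F F.2, ← Finset.sum_coe_sort (link σ)]
        simp only [hyz]
      rw [e2, div_mul_eq_mul_div, mul_div_assoc]
      refine mul_le_mul_of_nonneg_left ?_ (hu.normalize_pos hσ F.2).le
      rw [le_div_iff₀ (hpos F F.2), mul_comm]
      exact ih F F.2 u y (hpos F F.2)
    · rw [mixedDegree_cons, ← Finset.sum_coe_sort] at hx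
      rw [← hx]
      exact Finset.sum_congr rfl fun F _ => mul_comm _ _
  set q := mixedDegree w (u :: u :: u :: us) σ with hq
  refine isLorentzian_of_le_sq (s := fun x => mixedDegree w (x :: u :: u :: us) σ)
    (fun a b x y => mixedDegree_quadratic hw hσ a b x y _)
    (fun a b x y => mixedDegree_linear a b x y _ _) (k := 1 / q) fun x => ?_
  set p := mixedDegree w (x :: u :: u :: us) σ with hp
  have h1 := hneg ((1 : ℝ) • x + (-(p / q)) • u) (by
    rw [mixedDegree_linear, ← hp, ← hq]
    field_simp
    ring)
  rw [mixedDegree_quadratic hw hσ, ← hp, ← hq] at h1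
  have : 1 / q * p ^ 2 = -(2 * 1 * -(p / q) * p + (-(p / q)) ^ 2 * q) := by
    field_simp
    ring
  rw [this]
  linarith


/-! ### Flags missing two ranks -/

theorem incidence_quadForm {ι : Type*} (X Y : Finset ι) (e : ι → ι → ℝ) (x : ι → ℝ)
    (he : ∀ F ∈ X, ∀ F' ∈ X, ∑ G ∈ Y, e F G * e F' G = if F = F' then ∑ G ∈ Y, e F G else 1) :
    ∑ F ∈ X, x F * (∑ G ∈ Y, e F G * x G - (∑ G ∈ Y, e F G - 1) * x F) +
      ∑ G ∈ Y, x G * (∑ F ∈ X, e F G * x F - x G) =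
    (∑ F ∈ X, x F) ^ 2 - ∑ G ∈ Y, (x G - ∑ F ∈ X, e F G * x F) ^ 2 := by
  have h1 : ∑ G ∈ Y, (∑ F ∈ X, e F G * x F) ^ 2 =
      (∑ F ∈ X, x F) ^ 2 + ∑ F ∈ X, (∑ G ∈ Y, e F G - 1) * x F ^ 2 := by
    have e1 : ∀ G, (∑ F ∈ X, e F G * x F) ^ 2 =
        ∑ F ∈ X, ∑ F' ∈ X, (e F G * e F' G) * (x F * x F') := by
      intro G
      rw [sq, Finset.sum_mul_sum]
      exact Finset.sum_congr rfl fun F _ => Finset.sum_congr rfl fun F' _ => by ring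
    simp only [e1]
    rw [Finset.sum_comm, sq, Finset.sum_mul_sum, ← Finset.sum_add_distrib]
    refine Finset.sum_congr rfl fun F hF => ?_
    rw [Finset.sum_comm]
    have e2 : ∀ F' ∈ X, ∑ G ∈ Y, (e F G * e F' G) * (x F * x F') =
        x F * x F' + if F = F' then (∑ G ∈ Y, e F G - 1) * x F ^ 2 else 0 := by
      intro F' hF'
      rw [← Finset.sum_mul, he F hF F' hF']
      split_ifs with h
      · subst h; ring
      · ring
    rw [Finset.sum_congr rfl e2, Finset.sum_add_distrib, Finset.sum_ite_eq, if_pos hF]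
  have h2 : ∑ G ∈ Y, x G * ∑ F ∈ X, e F G * x F = ∑ F ∈ X, x F * ∑ G ∈ Y, e F G * x G := by
    simp only [Finset.mul_sum]
    rw [Finset.sum_comm]
    exact Finset.sum_congr rfl fun F _ => Finset.sum_congr rfl fun G _ => by ring
  have h3 : ∑ G ∈ Y, (x G - ∑ F ∈ X, e F G * x F) ^ 2 =
      ∑ G ∈ Y, (∑ F ∈ X, e F G * x F) ^ 2 - 2 * ∑ G ∈ Y, x G * ∑ F ∈ X, e F G * x F +
        ∑ G ∈ Y, x G * x G := by
    rw [Finset.mul_sum, ← Finset.sum_sub_distrib, ← Finset.sum_add_distrib]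
    exact Finset.sum_congr rfl fun G _ => by ring
  rw [h3, h1, h2]
  simp only [mul_sub, Finset.sum_sub_distrib]
  rw [h2]
  have h4 : ∀ F, x F * ((∑ G ∈ Y, e F G - 1) * x F) = (∑ G ∈ Y, e F G - 1) * x F ^ 2 := by
    intro F; ring
  simp only [h4]
  ring

/-- The elements of a given rank of the link. -/
noncomputable def linkRk (rk : L → ℕ) (σ : Finset L) (i : ℕ) : Finset L :=
  (link σ).filter (rk · = i)

theorem mem_linkRk {i : ℕ} : F ∈ linkRk rk σ i ↔ F ∈ link σ ∧ rk F = i := by simp [linkRk]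

namespace IsGeometric

variable {i j : ℕ}

theorem rk_of_mem_link (hg : IsGeometric rk w)
    (hm : ∀ k ≤ rk (⊤ : L), (∃ A ∈ σ, rk A = k) ↔ k ≠ i ∧ k ≠ j) (hF : F ∈ link σ) :
    rk F = i ∨ rk F = j := by
  by_contra! h
  obtain ⟨A, hA, hAF⟩ := (hm _ (hg.rk_le_top F)).2 h
  exact hg.rk_ne_of_mem_link hF hA hAF.symm

theorem sum_link (hg : IsGeometric rk w) (hij : i < j)
    (hm : ∀ k ≤ rk (⊤ : L), (∃ A ∈ σ, rk A = k) ↔ k ≠ i ∧ k ≠ j) (g : L → ℝ) :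
    ∑ F ∈ link σ, g F = ∑ F ∈ linkRk rk σ i, g F + ∑ F ∈ linkRk rk σ j, g F := by
  rw [linkRk, linkRk, ← Finset.sum_union]
  · refine Finset.sum_congr ?_ fun _ _ => rfl
    ext F
    simp only [Finset.mem_union, Finset.mem_filter, ← and_or_left]
    exact ⟨fun h => ⟨h, hg.rk_of_mem_link hm h⟩, fun h => h.1⟩
  · rw [Finset.disjoint_filter]
    omega

theorem link_insert_low (hg : IsGeometric rk w) (hij : i < j)
    (hm : ∀ k ≤ rk (⊤ : L), (∃ A ∈ σ, rk A = k) ↔ k ≠ i ∧ k ≠ j) (hF : F ∈ linkRk rk σ i) :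
    link (insert F σ) = (linkRk rk σ j).filter (F < ·) := by
  obtain ⟨h1, h2⟩ := mem_linkRk.1 hF
  ext G
  rw [mem_link_insert, Finset.mem_filter, mem_linkRk]
  constructor
  · rintro ⟨h3, h4⟩
    have h5 := hg.rk_of_mem_link hm h4
    rcases h3 with h3 | h3 <;> have := hg.rk_strictMono h3
    · exact ⟨⟨h4, by omega⟩, h3⟩
    · omega
  · rintro ⟨⟨h3, h4⟩, h5⟩
    exact ⟨.inl h5, h3⟩

theorem link_insert_high (hg : IsGeometric rk w) (hij : i < j)
    (hm : ∀ k ≤ rk (⊤ : L), (∃ A ∈ σ, rk A = k) ↔ k ≠ i ∧ k ≠ j) (hG : G ∈ linkRk rk σ j) :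
    link (insert G σ) = (linkRk rk σ i).filter (· < G) := by
  obtain ⟨h1, h2⟩ := mem_linkRk.1 hG
  ext F
  rw [mem_link_insert, Finset.mem_filter, mem_linkRk]
  constructor
  · rintro ⟨h3, h4⟩
    have h5 := hg.rk_of_mem_link hm h4
    rcases h3 with h3 | h3 <;> have := hg.rk_strictMono h3
    · omega
    · exact ⟨⟨h4, by omega⟩, h3⟩
  · rintro ⟨⟨h3, h4⟩, h5⟩
    exact ⟨.inr h5, h3⟩

theorem mixedDegree_pair (hg : IsGeometric rk w) (hij : i < j)
    (hm : ∀ k ≤ rk (⊤ : L), (∃ A ∈ σ, rk A = k) ↔ k ≠ i ∧ k ≠ j) (x : L → ℝ) :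
    mixedDegree w [x, x] σ =
      ∑ F ∈ linkRk rk σ i, normalize w σ x F *
        ∑ G ∈ (linkRk rk σ j).filter (F < ·), normalize w (insert F σ) x G +
      ∑ G ∈ linkRk rk σ j, normalize w σ x G *
        ∑ F ∈ (linkRk rk σ i).filter (· < G), normalize w (insert G σ) x F := by
  rw [mixedDegree_cons, hg.sum_link hij hm]
  congr 1
  · refine Finset.sum_congr rfl fun F hF => ?_
    simp only [hg.link_insert_low hij hm hF, mixedDegree, mul_one]
  · refine Finset.sum_congr rfl fun F hF => ?_
    simp only [hg.link_insert_high hij hm hF, mixedDegree, mul_one]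

theorem mixedDegree_pair_le_of_separated (hg : IsGeometric rk w) (hσ : IsFlag σ)
    (hij : i + 1 < j) (hj : j ≤ rk (⊤ : L))
    (hm : ∀ k ≤ rk (⊤ : L), (∃ A ∈ σ, rk A = k) ↔ k ≠ i ∧ k ≠ j) (x : L → ℝ) :
    mixedDegree w [x, x] σ ≤ (∑ F ∈ link σ, normalize w σ x F) ^ 2 := by
  have hij' : i < j := by omega
  obtain ⟨H, hH, hHi⟩ := (hm (i + 1) (by omega)).2 (by omega)
  have hX : ∀ F ∈ linkRk rk σ i, F < H := fun F hF =>
    hg.lt_of_rk_lt_of_mem_link' (mem_linkRk.1 hF).1 hH (by rw [(mem_linkRk.1 hF).2]; omega)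
  have hY : ∀ G ∈ linkRk rk σ j, H < G := fun G hG =>
    hg.lt_of_rk_lt_of_mem_link (mem_linkRk.1 hG).1 hH (by rw [(mem_linkRk.1 hG).2]; omega)
  have hsep : ∀ F ∈ linkRk rk σ i, ∀ G ∈ linkRk rk σ j,
      normalize w (insert F σ) x G = normalize w σ x G ∧
      normalize w (insert G σ) x F = normalize w σ x F := by
    intro F hF G hG
    have h1 := (mem_linkRk.1 hF).1
    have h2 := (mem_linkRk.1 hG).1
    exact ⟨normalize_insert_of_separated hσ h1 h2
      (.inr (((hσ.upper_spec h1).2.2 H hH (hX F hF)).trans_lt (hY G hG))) x,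
      normalize_insert_of_separated hσ h2 h1
      (.inl ((hX F hF).trans_le ((hσ.lower_spec h2).2.2 H hH (hY G hG)))) x⟩
  have e : mixedDegree w [x, x] σ = 2 * ((∑ F ∈ linkRk rk σ i, normalize w σ x F) *
      ∑ G ∈ linkRk rk σ j, normalize w σ x G) := by
    rw [hg.mixedDegree_pair hij' hm, two_mul]
    congr 1
    · rw [Finset.sum_mul]
      refine Finset.sum_congr rfl fun F hF => ?_
      rw [Finset.filter_true_of_mem fun G hG => (hX F hF).trans (hY G hG)]
      congr 1
      exact Finset.sum_congr rfl fun G hG => (hsep F hF G hG).1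
    · rw [mul_comm, Finset.sum_mul]
      refine Finset.sum_congr rfl fun G hG => ?_
      rw [Finset.filter_true_of_mem fun F hF => (hX F hF).trans (hY G hG)]
      congr 1
      exact Finset.sum_congr rfl fun F hF => (hsep F hF G hG).2
  rw [e, hg.sum_link hij' hm]
  nlinarith [sq_nonneg (∑ F ∈ linkRk rk σ i, normalize w σ x F),
    sq_nonneg (∑ F ∈ linkRk rk σ j, normalize w σ x F)]

theorem mixedDegree_pair_le_of_adjacent (hg : IsGeometric rk w) (hσ : IsFlag σ)
    (hj : i + 1 ≤ rk (⊤ : L))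
    (hm : ∀ k ≤ rk (⊤ : L), (∃ A ∈ σ, rk A = k) ↔ k ≠ i ∧ k ≠ i + 1) (x : L → ℝ) :
    mixedDegree w [x, x] σ ≤ (∑ F ∈ linkRk rk σ i, normalize w σ x F) ^ 2 := by
  have hi0 : i ≠ 0 := by
    have := ((hm 0 (by omega)).1 ⟨⊥, hσ.bot_mem, hg.rk_bot⟩).1
    omega
  have hit : i + 1 ≠ rk (⊤ : L) :=
    fun h => ((hm _ le_rfl).1 ⟨⊤, hσ.top_mem, rfl⟩).2 h.symm
  obtain ⟨A, hA, hAi⟩ := (hm (i - 1) (by omega)).2 (by omega)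
  obtain ⟨B, hB, hBi⟩ := (hm (i + 2) (by omega)).2 (by omega)
  have hσA : ∀ H ∈ σ, H ≤ A ∨ B ≤ H := by
    intro H hH
    have h1 := (hm _ (hg.rk_le_top H)).1 ⟨H, hH, rfl⟩
    rcases lt_trichotomy (rk H) (i - 1) with h | h | h
    · exact .inl (hg.lt_of_rk_lt hσ hH hA (by omega)).le
    · rcases hσ.total H hH A hA with h2 | h2 | h2
      · exact .inl h2.le
      · exact .inl h2.le
      · have := hg.rk_strictMono h2
        omega
    · rcases hσ.total H hH B hB with h2 | h2 | h2
      · have := hg.rk_strictMono h2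
        omega
      · exact .inr h2.ge
      · exact .inr h2.le
  have hgap : ∀ F, A < F → F < B → F ∈ link σ := fun F h1 h2 => mem_link.2 fun H hH =>
    (hσA H hH).imp (fun h => h.trans_lt h1) fun h => h2.trans_le h
  have hlow : ∀ F, A < F → F < B → lower σ F = A := fun F h1 h2 =>
    lower_eq hA h1 fun H hH hHF => (hσA H hH).resolve_right
      fun h => (h.trans_lt hHF).not_gt h2
  have hupp : ∀ F, A < F → F < B → upper σ F = B := fun F h1 h2 =>
    upper_eq hB h2 fun H hH hHF => (hσA H hH).resolve_left
      fun h => (hHF.trans_le h).not_gt h1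
  have hX : ∀ F ∈ linkRk rk σ i, A < F ∧ F < B := by
    intro F hF
    obtain ⟨h1, h2⟩ := mem_linkRk.1 hF
    exact ⟨hg.lt_of_rk_lt_of_mem_link h1 hA (by omega),
      hg.lt_of_rk_lt_of_mem_link' h1 hB (by omega)⟩
  have hY : ∀ F ∈ linkRk rk σ (i + 1), A < F ∧ F < B := by
    intro F hF
    obtain ⟨h1, h2⟩ := mem_linkRk.1 hF
    exact ⟨hg.lt_of_rk_lt_of_mem_link h1 hA (by omega),
      hg.lt_of_rk_lt_of_mem_link' h1 hB (by omega)⟩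
  have hw := hg.strictMono
  have hup : ∀ F ∈ linkRk rk σ i, ∑ G ∈ (linkRk rk σ (i + 1)).filter (F < ·),
      normalize w (insert F σ) x G =
      ∑ G ∈ linkRk rk σ (i + 1), (if F < G then (1 : ℝ) else 0) * normalize w σ x G -
        (∑ G ∈ linkRk rk σ (i + 1), (if F < G then (1 : ℝ) else 0) - 1) * normalize w σ x F := by
    intro F hF
    obtain ⟨hAF, hFB⟩ := hX F hF
    have hFl := (mem_linkRk.1 hF).1
    have h1 : ∀ G ∈ (linkRk rk σ (i + 1)).filter (F < ·), normalize w (insert F σ) x G =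
        normalize w σ x G - normalize w σ x F +
          (w G - w F) * (normalize w σ x F / (w B - w F)) := by
      intro G hG
      obtain ⟨hG1, hFG⟩ := Finset.mem_filter.1 hG
      rw [normalize_insert_above hw hσ hFl (mem_linkRk.1 hG1).1 hFG
        (by rw [hupp F hAF hFB]; exact (hY G hG1).2), hupp F hAF hFB]
      have : w B - w F ≠ 0 := (sub_pos.2 (hw hFB)).ne'
      field_simp
      ring
    have h2 : (linkRk rk σ (i + 1)).filter (F < ·) =
        Finset.univ.filter fun G => F ⋖ G ∧ G ≤ B := by
      ext G
      simp only [Finset.mem_filter, Finset.mem_univ, true_and]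
      constructor
      · rintro ⟨h3, h4⟩
        exact ⟨hg.covBy_of_lt h4 (by rw [(mem_linkRk.1 h3).2, (mem_linkRk.1 hF).2]),
          (hY G h3).2.le⟩
      · rintro ⟨h3, h4⟩
        have h5 := hg.rk_covBy _ _ h3
        rw [(mem_linkRk.1 hF).2] at h5
        refine ⟨mem_linkRk.2 ⟨hgap G (hAF.trans h3.lt) (h4.lt_of_ne ?_), h5⟩, h3.lt⟩
        rintro rfl
        omega
    rw [Finset.sum_congr rfl h1, Finset.sum_add_distrib, ← Finset.sum_mul, h2,
      hg.sum_covBy _ _ hFB, ← h2, mul_div_cancel₀ _ (sub_pos.2 (hw hFB)).ne',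
      Finset.sum_sub_distrib]
    simp only [ite_mul, one_mul, zero_mul, ← Finset.sum_filter, Finset.sum_const, nsmul_eq_mul,
      mul_one]
    ring
  have hdown : ∀ G ∈ linkRk rk σ (i + 1), ∑ F ∈ (linkRk rk σ i).filter (· < G),
      normalize w (insert G σ) x F =
      ∑ F ∈ linkRk rk σ i, (if F < G then (1 : ℝ) else 0) * normalize w σ x F -
        normalize w σ x G := by
    intro G hG
    obtain ⟨hAG, hGB⟩ := hY G hG
    have hGl := (mem_linkRk.1 hG).1
    have h1 : ∀ F ∈ (linkRk rk σ i).filter (· < G), normalize w (insert G σ) x F =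
        normalize w σ x F - (w F - w A) * (normalize w σ x G / (w G - w A)) := by
      intro F hF
      obtain ⟨hF1, hFG⟩ := Finset.mem_filter.1 hF
      rw [normalize_insert_below hw hσ hGl (mem_linkRk.1 hF1).1 hFG
        (by rw [hlow G hAG hGB]; exact (hX F hF1).1), hlow G hAG hGB]
      ring
    have h2 : (linkRk rk σ i).filter (· < G) =
        Finset.univ.filter fun F => A ⋖ F ∧ F ≤ G := by
      ext F
      simp only [Finset.mem_filter, Finset.mem_univ, true_and]
      constructor
      · rintro ⟨h3, h4⟩
        exact ⟨hg.covBy_of_lt (hX F h3).1 (by rw [(mem_linkRk.1 h3).2]; omega), h4.le⟩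
      · rintro ⟨h3, h4⟩
        have h5 := hg.rk_covBy _ _ h3
        have h6 := (mem_linkRk.1 hG).2
        have h7 : F < G := h4.lt_of_ne fun h => by subst h; omega
        exact ⟨mem_linkRk.2 ⟨hgap F h3.lt (h7.trans hGB), by omega⟩, h7⟩
    rw [Finset.sum_congr rfl h1, Finset.sum_sub_distrib, ← Finset.sum_mul, h2,
      hg.sum_covBy _ _ hAG, ← h2, mul_div_cancel₀ _ (sub_pos.2 (hw hAG)).ne']
    simp only [ite_mul, one_mul, zero_mul, ← Finset.sum_filter]
  rw [hg.mixedDegree_pair (Nat.lt_add_one i) hm,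
    Finset.sum_congr (s₁ := linkRk rk σ i) rfl fun F hF => by rw [hup F hF],
    Finset.sum_congr (s₁ := linkRk rk σ (i + 1)) rfl fun G hG => by rw [hdown G hG],
    incidence_quadForm (linkRk rk σ i) (linkRk rk σ (i + 1))
      (fun F G => if F < G then (1 : ℝ) else 0)]
  · have := Finset.sum_nonneg fun G (_ : G ∈ linkRk rk σ (i + 1)) =>
      sq_nonneg (normalize w σ x G -
        ∑ F ∈ linkRk rk σ i, (if F < G then (1 : ℝ) else 0) * normalize w σ x F)
    linarith
  · intro F hF F' hF'
    split_ifs with h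
    · subst h
      exact Finset.sum_congr rfl fun G _ => by split_ifs <;> simp
    · obtain ⟨hF1, hF2⟩ := mem_linkRk.1 hF
      obtain ⟨hF1', hF2'⟩ := mem_linkRk.1 hF'
      obtain ⟨H, h1, h2, h3⟩ := hg.exists_join A F F'
        (hg.covBy_of_lt (hX F hF).1 (by omega)) (hg.covBy_of_lt (hX F' hF').1 (by omega)) h
      have h4 := hg.rk_covBy _ _ h1
      have h5 : H < B := (h3 B (hX F hF).2.le (hX F' hF').2.le).lt_of_ne fun h => by
        subst h; omega
      rw [Finset.sum_eq_single_of_mem H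
        (mem_linkRk.2 ⟨hgap H ((hX F hF).1.trans h1.lt) h5, by omega⟩)]
      · simp [h1.lt, h2.lt]
      · intro G hG hGH
        have : ¬ (F < G ∧ F' < G) := fun ⟨h6, h7⟩ =>
          hGH (hg.eq_of_le (h3 G h6.le h7.le) (by rw [(mem_linkRk.1 hG).2]; omega)).symm
        by_cases h6 : F < G
        · simp [show ¬ F' < G from fun h7 => this ⟨h6, h7⟩]
        · simp [h6]

end IsGeometric

/-- The Hodge–Riemann relations for flags missing two ranks. -/
theorem isLorentzian_mixedDegree_pair (hg : IsGeometric rk w) (hσ : IsFlag σ)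
    (hcard : σ.card + 1 = rk (⊤ : L)) : IsLorentzian fun x y => mixedDegree w [x, y] σ := by
  have h1 := hg.card_missing hσ
  obtain ⟨i, j, hij, hS⟩ := Finset.card_eq_two.1
    (show (Finset.range (rk (⊤ : L) + 1) \ σ.image rk).card = 2 by omega)
  wlog hlt : i < j generalizing i j
  · exact this j i hij.symm (by rw [hS, Finset.pair_comm]) (by omega)
  have hm : ∀ k ≤ rk (⊤ : L), (∃ A ∈ σ, rk A = k) ↔ k ≠ i ∧ k ≠ j := by
    intro k hk
    have h2 := Finset.ext_iff.1 hS k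
    simp only [Finset.mem_sdiff, Finset.mem_range, Finset.mem_image, Finset.mem_insert,
      Finset.mem_singleton] at h2
    rw [← not_iff_not, ← not_or, not_not, ← h2]
    exact ⟨fun h => ⟨by omega, h⟩, fun h => h.2⟩
  have hj : j ≤ rk (⊤ : L) := by
    have h2 := (Finset.ext_iff.1 hS j).2 (by simp)
    have := Finset.mem_range.1 (Finset.mem_sdiff.1 h2).1
    omega
  have hw := hg.strictMono
  have hlin : ∀ (S : Finset L) (a b : ℝ) (x y : L → ℝ),
      ∑ F ∈ S, normalize w σ (a • x + b • y) F =
        a * ∑ F ∈ S, normalize w σ x F + b * ∑ F ∈ S, normalize w σ y F := by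
    intro S a b x y
    simp only [normalize_linear, Finset.sum_add_distrib, Finset.mul_sum]
  rcases Nat.lt_or_ge (i + 1) j with h | h
  · exact isLorentzian_of_le_sq (k := 1) (fun a b x y => mixedDegree_quadratic hw hσ a b x y _)
      (hlin _) fun x => by
        rw [one_mul]; exact hg.mixedDegree_pair_le_of_separated hσ h hj hm x
  · obtain rfl : j = i + 1 := by omega
    exact isLorentzian_of_le_sq (k := 1) (fun a b x y => mixedDegree_quadratic hw hσ a b x y _)
      (hlin _) fun x => by
        rw [one_mul]; exact hg.mixedDegree_pair_le_of_adjacent hσ hj hm x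

/-- The Hodge–Riemann relations in degree one. -/
theorem isLorentzian_mixedDegree (hg : IsGeometric rk w) {us : List (L → ℝ)}
    (hus : ∀ u ∈ us, IsConcave w u) (hσ : IsFlag σ)
    (hcard : σ.card + us.length + 1 = rk (⊤ : L)) :
    IsLorentzian fun x y => mixedDegree w (x :: y :: us) σ := by
  induction us generalizing σ with
  | nil => exact isLorentzian_mixedDegree_pair hg hσ hcard
  | cons u us ih =>
    rw [List.length_cons] at hcard
    refine isLorentzian_mixedDegree_cons hg hσ (hus u (by simp))
      (fun u hu => hus u (by simp [hu])) (by omega) fun F hF => ?_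
    exact ih (fun u hu => hus u (by simp [hu])) (hσ.insert hF)
      (by rw [card_insert_of_mem_link hF]; omega)


/-! ### Degenerations of strictly concave divisors -/

/-- Concavity with respect to the weight. -/
def IsWeaklyConcave (w u : L → ℝ) : Prop := ∀ A B F, A < F → F < B → 0 ≤ interpDefect w A B u F

theorem IsWeaklyConcave.add_smul_sq (hw : StrictMono w) {u : L → ℝ} (hu : IsWeaklyConcave w u)
    {ε : ℝ} (hε : 0 < ε) : IsConcave w (u + ε • fun F => -w F ^ 2) := by
  intro A B F hAF hFB
  have h1 : 0 < w F - w A := sub_pos.2 (hw hAF)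
  have h2 : 0 < w B - w F := sub_pos.2 (hw hFB)
  have h3 : w B - w A ≠ 0 := by linarith
  have : interpDefect w A B (u + ε • fun F => -w F ^ 2) F =
      interpDefect w A B u F + ε * ((w F - w A) * (w B - w F)) := by
    simp only [interpDefect, Pi.add_apply, Pi.smul_apply, smul_eq_mul]
    field_simp
    ring
  rw [this]
  have := hu A B F hAF hFB
  positivity

theorem continuous_mixedDegree (q : L → ℝ) (us : List (L → ℝ)) (σ : Finset L) :
    Continuous fun ε : ℝ => mixedDegree w (us.map fun u => u + ε • q) σ := by
  induction us generalizing σ with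
  | nil => exact continuous_const
  | cons u us ih =>
    simp only [List.map_cons, mixedDegree_cons]
    refine continuous_finsetSum _ fun F _ => Continuous.mul ?_ (ih _)
    simp only [normalize, interpDefect, Pi.add_apply, Pi.smul_apply, smul_eq_mul]
    fun_prop

theorem mixedDegree_mul_le_sq (hg : IsGeometric rk w) {x y : L → ℝ} {us : List (L → ℝ)}
    (hx : IsWeaklyConcave w x) (hus : ∀ u ∈ us, IsWeaklyConcave w u)
    (hσ : IsFlag σ) (hcard : σ.card + us.length + 1 = rk (⊤ : L)) :
    mixedDegree w (x :: x :: us) σ * mixedDegree w (y :: y :: us) σ ≤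
      mixedDegree w (x :: y :: us) σ ^ 2 := by
  have hw := hg.strictMono
  set q : L → ℝ := fun F => -w F ^ 2 with hq
  have hlim : ∀ vs : List (L → ℝ), Filter.Tendsto
      (fun ε : ℝ => mixedDegree w (vs.map fun u => u + ε • q) σ) (nhdsWithin 0 (Set.Ioi 0))
      (nhds (mixedDegree w vs σ)) := by
    intro vs
    have h1 := ((continuous_mixedDegree (w := w) q vs σ).tendsto 0).mono_left
      (nhdsWithin_le_nhds (s := Set.Ioi 0))
    simpa using h1
  refine le_of_tendsto_of_tendsto ((hlim _).mul (hlim _)) ((hlim _).pow 2) ?_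
  filter_upwards [self_mem_nhdsWithin] with ε hε
  have hε : 0 < ε := hε
  have hus' : ∀ u ∈ us.map fun u => u + ε • q, IsConcave w u := by
    intro u hu
    obtain ⟨v, hv, rfl⟩ := List.mem_map.1 hu
    exact (hus v hv).add_smul_sq hw hε
  refine isLorentzian_mixedDegree hg hus' hσ (by simpa using hcard) _ _
    (mixedDegree_pos hg ?_ hσ ?_)
  · simpa using ⟨hx.add_smul_sq hw hε, by simpa using hus'⟩
  · simp only [List.length_cons, List.length_map]
    omega

/-! ### The two distinguished divisors -/

/-- The divisor supported on the top element. -/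
noncomputable def topDiv (F : L) : ℝ := if F = ⊤ then -1 else 0

/-- The divisor supported on the bottom element. -/
noncomputable def botDiv (F : L) : ℝ := if F = ⊥ then -1 else 0

theorem interpDefect_topDiv (hAF : A < F) (hFB : F < B) :
    interpDefect w A B topDiv F = if B = ⊤ then (w F - w A) / (w B - w A) else 0 := by
  have h1 : F ≠ ⊤ := hFB.ne_top
  have h2 : A ≠ ⊤ := hAF.ne_top
  simp only [interpDefect, topDiv, h1, h2, if_false]
  split_ifs <;> ring

theorem interpDefect_botDiv (hAF : A < F) (hFB : F < B) :
    interpDefect w A B botDiv F = if A = ⊥ then (w B - w F) / (w B - w A) else 0 := by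
  have h1 : F ≠ ⊥ := hAF.ne_bot
  have h2 : B ≠ ⊥ := hFB.ne_bot
  simp only [interpDefect, botDiv, h1, h2, if_false]
  split_ifs <;> ring

theorem isWeaklyConcave_topDiv (hw : StrictMono w) : IsWeaklyConcave w topDiv := by
  intro A B F hAF hFB
  rw [interpDefect_topDiv hAF hFB]
  split_ifs
  · exact div_nonneg (sub_nonneg.2 (hw hAF).le) (sub_nonneg.2 (hw (hAF.trans hFB)).le)
  · exact le_rfl

theorem isWeaklyConcave_botDiv (hw : StrictMono w) : IsWeaklyConcave w botDiv := by
  intro A B F hAF hFB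
  rw [interpDefect_botDiv hAF hFB]
  split_ifs
  · exact div_nonneg (sub_nonneg.2 (hw hFB).le) (sub_nonneg.2 (hw (hAF.trans hFB)).le)
  · exact le_rfl

theorem normalize_topDiv (hσ : IsFlag σ) (hF : F ∈ link σ) :
    normalize w σ topDiv F = if upper σ F = ⊤ then
      (w F - w (lower σ F)) / (w (upper σ F) - w (lower σ F)) else 0 :=
  interpDefect_topDiv (hσ.lower_spec hF).2.1 (hσ.upper_spec hF).2.1

theorem normalize_botDiv (hσ : IsFlag σ) (hF : F ∈ link σ) :
    normalize w σ botDiv F = if lower σ F = ⊥ then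
      (w (upper σ F) - w F) / (w (upper σ F) - w (lower σ F)) else 0 :=
  interpDefect_botDiv (hσ.lower_spec hF).2.1 (hσ.upper_spec hF).2.1

namespace IsGeometric

theorem mixedDegree_topDiv_eq_zero (hg : IsGeometric rk w) {j : ℕ} (us : List (L → ℝ))
    (hσ : IsFlag σ) (hG : G ∈ σ) (hGt : G ≠ ⊤) (hj : rk (⊤ : L) ≤ rk G + (j + 1)) :
    mixedDegree w (List.replicate (j + 1) topDiv ++ us) σ = 0 := by
  induction j generalizing G σ with
  | zero =>
    rw [List.replicate_succ, List.cons_append, mixedDegree_cons]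
    refine Finset.sum_eq_zero fun F hF => ?_
    rw [normalize_topDiv hσ hF]
    split_ifs with h
    · exfalso
      rcases mem_link.1 hF G hG with h1 | h1
      · have := hg.rk_strictMono h1
        have := hg.rk_strictMono (hσ.lt_top hF)
        omega
      · have := (hσ.upper_spec hF).2.2 G hG h1
        rw [h] at this
        exact hGt (top_le_iff.1 this)
    · rw [zero_mul]
  | succ j ih =>
    rw [List.replicate_succ, List.cons_append, mixedDegree_cons]
    refine Finset.sum_eq_zero fun F hF => ?_
    rw [normalize_topDiv hσ hF]
    split_ifs with h
    · rcases mem_link.1 hF G hG with h1 | h1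
      · have := hg.rk_strictMono h1
        rw [ih (hσ.insert hF) (Finset.mem_insert_self _ _) (hσ.lt_top hF).ne (by omega),
          mul_zero]
      · have := (hσ.upper_spec hF).2.2 G hG h1
        rw [h] at this
        exact absurd (top_le_iff.1 this) hGt
    · rw [zero_mul]

theorem mixedDegree_botDiv_eq_zero (hg : IsGeometric rk w) {j : ℕ} (us : List (L → ℝ))
    (hσ : IsFlag σ) (hG : G ∈ σ) (hGb : G ≠ ⊥) (hj : rk G ≤ j + 1) :
    mixedDegree w (List.replicate (j + 1) botDiv ++ us) σ = 0 := by
  induction j generalizing G σ with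
  | zero =>
    rw [List.replicate_succ, List.cons_append, mixedDegree_cons]
    refine Finset.sum_eq_zero fun F hF => ?_
    rw [normalize_botDiv hσ hF]
    split_ifs with h
    · exfalso
      rcases mem_link.1 hF G hG with h1 | h1
      · have := (hσ.lower_spec hF).2.2 G hG h1
        rw [h] at this
        exact hGb (le_bot_iff.1 this)
      · have := hg.rk_strictMono h1
        have := hg.rk_strictMono (hσ.bot_lt hF)
        omega
    · rw [zero_mul]
  | succ j ih =>
    rw [List.replicate_succ, List.cons_append, mixedDegree_cons]
    refine Finset.sum_eq_zero fun F hF => ?_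
    rw [normalize_botDiv hσ hF]
    split_ifs with h
    · rcases mem_link.1 hF G hG with h1 | h1
      · have := (hσ.lower_spec hF).2.2 G hG h1
        rw [h] at this
        exact absurd (le_bot_iff.1 this) hGb
      · have := hg.rk_strictMono h1
        rw [ih (hσ.insert hF) (Finset.mem_insert_self _ _) (hσ.bot_lt hF).ne' (by omega),
          mul_zero]
    · rw [zero_mul]

theorem mixedDegree_topDiv_eq (hg : IsGeometric rk w) {p : ℕ} {us : List (L → ℝ)} {c : ℝ}
    (hσ : IsFlag σ) (hA : A ∈ σ) (hrk : rk A + p + 1 = rk (⊤ : L))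
    (hσA : ∀ H ∈ σ, H ≤ A ∨ H = ⊤)
    (hc : ∀ τ, IsFlag τ → σ ⊆ τ → (∀ H ∈ τ, H ∈ σ ∨ A < H) → mixedDegree w us τ = c) :
    mixedDegree w (List.replicate p topDiv ++ us) σ = c := by
  induction p generalizing A σ with
  | zero => exact hc σ hσ (Finset.Subset.refl _) fun H hH => .inl hH
  | succ p ih =>
    have hw := hg.strictMono
    have hAt : A < ⊤ := lt_top_iff_ne_top.2 fun h => by subst h; omega
    rw [List.replicate_succ, List.cons_append, mixedDegree_cons]
    have hlow : ∀ F, A < F → F < ⊤ → lower σ F = A := fun F h1 h2 =>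
      lower_eq hA h1 fun H hH hHF => (hσA H hH).resolve_right
        fun h => by subst h; exact hHF.not_gt h2
    have hupp : ∀ F, A < F → F < ⊤ → upper σ F = ⊤ := fun F h1 h2 =>
      upper_eq hσ.top_mem h2 fun H hH hHF => ((hσA H hH).resolve_left
        fun h => (hHF.trans_le h).not_gt h1).ge
    have hlink : ∀ F, A < F → F < ⊤ → F ∈ link σ := fun F h1 h2 => mem_link.2 fun H hH =>
      (hσA H hH).imp (fun h => h.trans_lt h1) fun h => by rw [h]; exact h2
    have h1 : ∑ F ∈ Finset.univ.filter (fun F => A ⋖ F ∧ F ≤ ⊤),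
        (w F - w A) / (w (⊤ : L) - w A) * c = c := by
      rw [← Finset.sum_mul, ← Finset.sum_div, hg.sum_covBy _ _ hAt,
        div_self (sub_pos.2 (hw hAt)).ne', one_mul]
    rw [← h1]
    symm
    have hcov : ∀ F, A ⋖ F → F < ⊤ := fun F hF => lt_top_iff_ne_top.2 fun h => by
      have := hg.rk_covBy _ _ hF
      subst h
      omega
    refine Finset.sum_subset_zero_on_sdiff (fun F hF => ?_) (fun F hF => ?_) fun F hF => ?_
    · obtain ⟨h2, -⟩ := (Finset.mem_filter.1 hF).2
      exact hlink F h2.lt (hcov F h2)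
    · obtain ⟨h2, h3⟩ := Finset.mem_sdiff.1 hF
      rw [normalize_topDiv hσ h2]
      split_ifs with h4
      · have h5 : A < F := (mem_link.1 h2 A hA).resolve_right fun h => by
          have := (hσ.upper_spec h2).2.2 A hA h
          rw [h4] at this
          exact hAt.not_ge this
        have h6 := hg.rk_strictMono h5
        have h7 : ¬ rk F ≤ rk A + 1 := fun h =>
          h3 (Finset.mem_filter.2 ⟨Finset.mem_univ _, hg.covBy_of_lt h5 h, le_top⟩)
        have h8 := hg.rk_strictMono (hσ.lt_top h2)
        obtain ⟨p, rfl⟩ : ∃ p', p = p' + 1 := ⟨p - 1, by omega⟩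
        rw [hg.mixedDegree_topDiv_eq_zero _ (hσ.insert h2) (Finset.mem_insert_self _ _)
          (hσ.lt_top h2).ne (by omega), mul_zero]
      · rw [zero_mul]
    · obtain ⟨h2, -⟩ := (Finset.mem_filter.1 hF).2
      have h3 := hlink F h2.lt (hcov F h2)
      have h4 := hg.rk_covBy _ _ h2
      rw [normalize_topDiv hσ h3, hlow F h2.lt (hcov F h2), hupp F h2.lt (hcov F h2), if_pos rfl,
        ih (hσ.insert h3) (Finset.mem_insert_self _ _) (by omega)]
      · intro H hH
        rcases Finset.mem_insert.1 hH with rfl | hH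
        · exact .inl le_rfl
        · exact (hσA H hH).imp (fun h => h.trans h2.le) id
      · intro τ hτ h5 h6
        refine hc τ hτ ((Finset.subset_insert _ _).trans h5) fun H hH => ?_
        rcases h6 H hH with h7 | h7
        · rcases Finset.mem_insert.1 h7 with rfl | h7
          · exact .inr h2.lt
          · exact .inl h7
        · exact .inr (h2.lt.trans h7)

variable {b : L → ℝ}

theorem mixedDegree_botDiv_eq (hg : IsGeometric rk w) (hb0 : b (⊥ : L) = 1)
    (hb : ∀ F : L, ⊥ < F → w F * b F = ∑ H : L with H ⋖ F, (w F - w H) * b H) {k : ℕ}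
    (hσ : IsFlag σ) (hF : F ∈ σ) (hrk : rk F = k + 1) (hσF : ∀ H ∈ σ, H = ⊥ ∨ F ≤ H) :
    mixedDegree w (List.replicate k botDiv) σ = b F := by
  have hw := hg.strictMono
  induction k generalizing F σ with
  | zero =>
    have hF0 : ⊥ < F := bot_lt_iff_ne_bot.2 fun h => by
      subst h; rw [hg.rk_bot] at hrk; omega
    have h1 := hb F hF0
    have h2 : (Finset.univ.filter fun H : L => H ⋖ F) = {⊥} := by
      ext H
      simp only [Finset.mem_filter, Finset.mem_univ, true_and, Finset.mem_singleton]
      constructor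
      · intro h
        have := hg.rk_covBy _ _ h
        exact (hg.eq_of_le bot_le (by rw [hg.rk_bot]; omega)).symm
      · rintro rfl
        exact hg.covBy_of_lt hF0 (by rw [hg.rk_bot, hrk])
    have h3 : 0 < w F := hg.weight_bot ▸ hw hF0
    rw [h2, Finset.sum_singleton, hb0, hg.weight_bot, sub_zero] at h1
    exact (mul_left_cancel₀ h3.ne' h1).symm
  | succ k ih =>
    have hF0 : ⊥ < F := bot_lt_iff_ne_bot.2 fun h => by
      subst h; rw [hg.rk_bot] at hrk; omega
    have h3 : 0 < w F := hg.weight_bot ▸ hw hF0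
    have hlow : ∀ G, ⊥ < G → G < F → lower σ G = ⊥ := fun G h1 h2 =>
      lower_eq hσ.bot_mem h1 fun H hH hHG => ((hσF H hH).resolve_right
        fun h => (hHG.trans h2).not_ge h).le
    have hupp : ∀ G, ⊥ < G → G < F → upper σ G = F := fun G h1 h2 =>
      upper_eq hF h2 fun H hH hHG => (hσF H hH).resolve_left fun h => by
        subst h; exact not_lt_bot hHG
    have hlink : ∀ G, ⊥ < G → G < F → G ∈ link σ := fun G h1 h2 => mem_link.2 fun H hH =>
      (hσF H hH).imp (fun h => by rw [h]; exact h1) fun h => h2.trans_le h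
    have hcov : ∀ G, G ⋖ F → ⊥ < G := fun G hG => bot_lt_iff_ne_bot.2 fun h => by
      have := hg.rk_covBy _ _ hG
      subst h
      rw [hg.rk_bot] at this
      omega
    rw [List.replicate_succ, mixedDegree_cons]
    have h1 : ∑ G : L with G ⋖ F, (w F - w G) / w F * b G = b F := by
      have e : ∀ G, (w F - w G) / w F * b G = (w F - w G) * b G / w F := fun G => by ring
      simp only [e]
      rw [← Finset.sum_div, ← hb F hF0, mul_div_cancel_left₀ _ h3.ne']
    rw [← h1]
    symm
    refine Finset.sum_subset_zero_on_sdiff (fun G hG => ?_) (fun G hG => ?_) fun G hG => ?_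
    · have h2 := (Finset.mem_filter.1 hG).2
      exact hlink G (hcov G h2) h2.lt
    · obtain ⟨h2, h3⟩ := Finset.mem_sdiff.1 hG
      rw [normalize_botDiv hσ h2]
      split_ifs with h4
      · have h5 : G < F := (mem_link.1 h2 F hF).resolve_left fun h => by
          have := (hσ.lower_spec h2).2.2 F hF h
          rw [h4] at this
          exact hF0.not_ge this
        have h6 := hg.rk_strictMono h5
        have h7 : ¬ rk F ≤ rk G + 1 := fun h =>
          h3 (Finset.mem_filter.2 ⟨Finset.mem_univ _, hg.covBy_of_lt h5 h⟩)
        have h8 := hg.rk_strictMono (hσ.bot_lt h2)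
        obtain ⟨k, rfl⟩ : ∃ k', k = k' + 1 := ⟨k - 1, by omega⟩
        have h9 := hg.mixedDegree_botDiv_eq_zero (j := k) [] (hσ.insert h2)
          (Finset.mem_insert_self _ _) (hσ.bot_lt h2).ne' (by omega)
        rw [List.append_nil] at h9
        rw [h9, mul_zero]
      · rw [zero_mul]
    · have h2 := (Finset.mem_filter.1 hG).2
      have h3 := hlink G (hcov G h2) h2.lt
      have h4 := hg.rk_covBy _ _ h2
      rw [normalize_botDiv hσ h3, hlow G (hcov G h2) h2.lt, hupp G (hcov G h2) h2.lt, if_pos rfl,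
        ih (hσ.insert h3) (Finset.mem_insert_self _ _) (by omega), hg.weight_bot, sub_zero]
      intro H hH
      rcases Finset.mem_insert.1 hH with rfl | hH
      · exact .inr le_rfl
      · exact (hσF H hH).imp id fun h => h2.le.trans h

theorem isFlag_bot_top : IsFlag ({⊥, ⊤} : Finset L) where
  bot_mem := by simp
  top_mem := by simp
  total := by
    intro A hA B hB
    simp only [Finset.mem_insert, Finset.mem_singleton] at hA hB
    rcases hA with rfl | rfl <;> rcases hB with rfl | rfl
    · exact .inr (.inl rfl)
    · exact (bot_le (a := (⊤ : L))).lt_or_eq.imp id .inl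
    · exact .inr ((bot_le (a := (⊤ : L))).lt_or_eq.elim .inr fun h => .inl h.symm)
    · exact .inr (.inl rfl)

theorem mixedDegree_topDiv_botDiv (hg : IsGeometric rk w) (hb0 : b (⊥ : L) = 1)
    (hb : ∀ F : L, ⊥ < F → w F * b F = ∑ H : L with H ⋖ F, (w F - w H) * b H) {p k : ℕ}
    (hrk : p + k + 1 = rk (⊤ : L)) :
    mixedDegree w (List.replicate p topDiv ++ List.replicate k botDiv) {⊥, ⊤} =
      ∑ F : L with rk F = k + 1, w F / w (⊤ : L) * b F := by
  have hw := hg.strictMono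
  have hσ := isFlag_bot_top (L := L)
  have hbt : (⊥ : L) < ⊤ := bot_lt_iff_ne_bot.2 fun h => by
    have := hg.rk_bot
    rw [← h] at this
    omega
  have hwt : 0 < w (⊤ : L) := hg.weight_bot ▸ hw hbt
  cases p with
  | zero =>
    have h1 : (Finset.univ.filter fun F : L => rk F = k + 1) = {⊤} := by
      ext F
      simp only [Finset.mem_filter, Finset.mem_univ, true_and, Finset.mem_singleton]
      constructor
      · intro h
        exact hg.eq_of_le le_top (by omega)
      · rintro rfl
        omega
    rw [h1, Finset.sum_singleton, div_self hwt.ne', one_mul, List.replicate_zero,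
      List.nil_append]
    refine hg.mixedDegree_botDiv_eq hb0 hb hσ (by simp) (by omega) fun H hH => ?_
    simpa [top_le_iff] using hH
  | succ p =>
    have hlink : ∀ F, F ∈ link ({⊥, ⊤} : Finset L) ↔ ⊥ < F ∧ F < ⊤ := by
      intro F
      simp [mem_link]
    have hlow : ∀ F, ⊥ < F → F < ⊤ → lower ({⊥, ⊤} : Finset L) F = ⊥ := fun F h1 h2 =>
      lower_eq (by simp) h1 fun H hH hHF => by
        simp only [Finset.mem_insert, Finset.mem_singleton] at hH
        rcases hH with rfl | rfl
        · exact le_rfl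
        · exact absurd hHF not_top_lt
    have hupp : ∀ F, ⊥ < F → F < ⊤ → upper ({⊥, ⊤} : Finset L) F = ⊤ := fun F h1 h2 =>
      upper_eq (by simp) h2 fun H hH hHF => by
        simp only [Finset.mem_insert, Finset.mem_singleton] at hH
        rcases hH with rfl | rfl
        · exact absurd hHF not_lt_bot
        · exact le_rfl
    rw [List.replicate_succ, List.cons_append, mixedDegree_cons]
    symm
    have hgap : ∀ F : L, rk F = k + 1 → ⊥ < F ∧ F < ⊤ := by
      refine fun F hF => ⟨bot_lt_iff_ne_bot.2 fun h => ?_, lt_top_iff_ne_top.2 fun h => ?_⟩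
      · subst h
        rw [hg.rk_bot] at hF
        omega
      · subst h
        omega
    refine Finset.sum_subset_zero_on_sdiff (fun F hF => ?_) (fun F hF => ?_) fun F hF => ?_
    · exact (hlink F).2 (hgap F (Finset.mem_filter.1 hF).2)
    · obtain ⟨h2, h3⟩ := Finset.mem_sdiff.1 hF
      obtain ⟨h4, h5⟩ := (hlink F).1 h2
      have h6 : rk F ≠ k + 1 := by simpa using h3
      have h7 := hg.rk_strictMono h4
      have h8 := hg.rk_strictMono h5
      rcases lt_or_gt_of_ne h6 with h | h
      · obtain ⟨k, rfl⟩ : ∃ k', k = k' + 1 := ⟨k - 1, by omega⟩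
        rw [mixedDegree_perm hw List.perm_append_comm _ (hσ.insert h2),
          hg.mixedDegree_botDiv_eq_zero _ (hσ.insert h2) (Finset.mem_insert_self _ _) h4.ne'
            (by omega), mul_zero]
      · obtain ⟨p, rfl⟩ : ∃ p', p = p' + 1 := ⟨p - 1, by omega⟩
        rw [hg.mixedDegree_topDiv_eq_zero _ (hσ.insert h2) (Finset.mem_insert_self _ _) h5.ne
            (by omega), mul_zero]
    · have h2 := (Finset.mem_filter.1 hF).2
      obtain ⟨h4, h5⟩ := hgap F h2
      have h3 := (hlink F).2 ⟨h4, h5⟩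
      rw [normalize_topDiv hσ h3, hlow F h4 h5, hupp F h4 h5, if_pos rfl, hg.weight_bot,
        sub_zero, sub_zero, hg.mixedDegree_topDiv_eq (hσ.insert h3) (Finset.mem_insert_self _ _)
          (by omega)]
      · intro H hH
        simp only [Finset.mem_insert, Finset.mem_singleton] at hH
        rcases hH with rfl | rfl | rfl
        · exact .inl le_rfl
        · exact .inl bot_le
        · exact .inr rfl
      · intro τ hτ h6 h7
        refine hg.mixedDegree_botDiv_eq hb0 hb hτ (h6 (Finset.mem_insert_self _ _)) h2 ?_
        intro H hH
        rcases h7 H hH with h8 | h8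
        · simp only [Finset.mem_insert, Finset.mem_singleton] at h8
          rcases h8 with rfl | rfl | rfl
          · exact .inr le_rfl
          · exact .inl rfl
          · exact .inr le_top
        · exact .inr h8.le

/-- The weighted sums over the elements of given rank are log-concave. -/
theorem logConcave (hg : IsGeometric rk w) (hb0 : b (⊥ : L) = 1)
    (hb : ∀ F : L, ⊥ < F → w F * b F = ∑ H : L with H ⋖ F, (w F - w H) * b H) (k : ℕ) :
    (∑ F : L with rk F = k, w F / w (⊤ : L) * b F) *
      (∑ F : L with rk F = k + 2, w F / w (⊤ : L) * b F) ≤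
      (∑ F : L with rk F = k + 1, w F / w (⊤ : L) * b F) ^ 2 := by
  have hw := hg.strictMono
  rcases Nat.eq_zero_or_pos k with rfl | hk
  · rw [Finset.sum_eq_zero, zero_mul]
    · exact sq_nonneg _
    · intro F hF
      have h1 : (⊥ : L) = F :=
        hg.eq_of_le bot_le (by rw [(Finset.mem_filter.1 hF).2]; exact Nat.zero_le _)
      rw [← h1, hg.weight_bot, zero_div, zero_mul]
  obtain ⟨k, rfl⟩ : ∃ k', k = k' + 1 := ⟨k - 1, by omega⟩
  rcases Nat.lt_or_ge (rk (⊤ : L)) (k + 3) with h | h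
  · rw [mul_comm, Finset.sum_eq_zero, zero_mul]
    · exact sq_nonneg _
    · intro F hF
      have h1 := (Finset.mem_filter.1 hF).2
      have := hg.rk_le_top F
      omega
  obtain ⟨p, hp⟩ : ∃ p, p + k + 3 = rk (⊤ : L) := ⟨rk (⊤ : L) - (k + 3), by omega⟩
  have hσ := isFlag_bot_top (L := L)
  have hbt : (⊥ : L) ≠ ⊤ := fun h => by
    have := hg.rk_bot
    rw [h] at this
    omega
  have key := mixedDegree_mul_le_sq hg (isWeaklyConcave_topDiv hw) (y := botDiv)
    (us := List.replicate p topDiv ++ List.replicate k botDiv) ?_ hσ ?_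
  · rw [← hg.mixedDegree_topDiv_botDiv hb0 hb (p := p + 2) (k := k) (by omega),
      ← hg.mixedDegree_topDiv_botDiv hb0 hb (p := p + 1) (k := k + 1) (by omega),
      ← hg.mixedDegree_topDiv_botDiv hb0 hb (p := p) (k := k + 2) (by omega)]
    have e1 : mixedDegree w (topDiv :: botDiv ::
        (List.replicate p topDiv ++ List.replicate k botDiv)) ({⊥, ⊤} : Finset L) =
        mixedDegree w (List.replicate (p + 1) topDiv ++ List.replicate (k + 1) botDiv)
          {⊥, ⊤} := by
      refine mixedDegree_perm hw ?_ _ hσ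
      rw [List.replicate_succ, List.replicate_succ, List.cons_append]
      exact List.perm_middle.symm.cons _
    have e2 : mixedDegree w (botDiv :: botDiv ::
        (List.replicate p topDiv ++ List.replicate k botDiv)) ({⊥, ⊤} : Finset L) =
        mixedDegree w (List.replicate p topDiv ++ List.replicate (k + 2) botDiv)
          {⊥, ⊤} := by
      refine mixedDegree_perm hw ?_ _ hσ
      rw [List.replicate_succ, List.replicate_succ]
      exact ((List.perm_middle.symm.cons _).trans List.perm_middle.symm)
    rw [← e1, ← e2]
    exact key
  · intro u hu
    rcases List.mem_append.1 hu with h1 | h1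
    · rw [List.eq_of_mem_replicate h1]
      exact isWeaklyConcave_topDiv hw
    · rw [List.eq_of_mem_replicate h1]
      exact isWeaklyConcave_botDiv hw
  · rw [Finset.card_pair hbt, List.length_append, List.length_replicate, List.length_replicate]
    omega

end IsGeometric


/-- A sequence of sums of consecutive terms of a positive log-concave sequence is unimodal. -/
theorem exists_unimodal_index {n : ℕ} {f g : ℕ → ℝ} (hpos : ∀ k, 1 ≤ k → k ≤ n → 0 < g k)
    (h0 : g 0 = 0) (hlc : ∀ k, g k * g (k + 2) ≤ g (k + 1) ^ 2)
    (hf : ∀ k ≤ n, f k = g k + g (k + 1)) :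
    ∃ k₀ ≤ n, (∀ i j : ℕ, i ≤ j → j ≤ k₀ → f i ≤ f j) ∧
      (∀ i j : ℕ, k₀ ≤ i → i ≤ j → j ≤ n → f j ≤ f i) := by
  have hstep : ∀ k, k + 2 ≤ n → f (k + 1) ≤ f k → f (k + 2) ≤ f (k + 1) := by
    intro k hk h
    rw [hf _ (by omega), hf _ (by omega)] at h
    rw [hf _ (by omega), hf _ (by omega)]
    have h1 := hpos (k + 1) (by omega) (by omega)
    have h2 := hpos (k + 2) (by omega) (by omega)
    rcases Nat.eq_zero_or_pos k with rfl | hk0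
    · simp only [zero_add] at h h1 h2
      linarith
    have h3 := hpos k hk0 (by omega)
    have h4 := hlc k
    have h5 := hlc (k + 1)
    have h6 : g (k + 3) * g k ≤ g (k + 1) * g (k + 2) := by
      have h7 : g k * g (k + 2) * (g (k + 1) * g (k + 3)) ≤ g (k + 1) ^ 2 * g (k + 2) ^ 2 := by
        rcases le_total 0 (g (k + 1) * g (k + 3)) with h8 | h8
        · exact mul_le_mul h4 h5 h8 (sq_nonneg _)
        · exact (mul_nonpos_of_nonneg_of_nonpos (mul_pos h3 h2).le h8).trans (by positivity)
      refine le_of_mul_le_mul_right ?_ (mul_pos h1 h2)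
      calc _ = g k * g (k + 2) * (g (k + 1) * g (k + 3)) := by ring
        _ ≤ _ := h7
        _ = _ := by ring
    have h7 : g (k + 3) ≤ g (k + 1) := by
      refine le_of_mul_le_mul_right (h6.trans ?_) h3
      exact mul_le_mul_of_nonneg_left (by linarith) h1.le
    have e : g (k + 2 + 1) = g (k + 3) := rfl
    have e' : g (k + 1 + 1) = g (k + 2) := rfl
    rw [e, e']
    linarith
  have hex : ∃ k, k = n ∨ f (k + 1) < f k := ⟨n, .inl rfl⟩
  refine ⟨Nat.find hex, Nat.find_min' hex (.inl rfl), ?_, ?_⟩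
  · intro i j hij hj
    induction j, hij using Nat.le_induction with
    | base => exact le_rfl
    | succ j hij ih =>
      have h1 := Nat.find_min hex (show j < Nat.find hex by omega)
      push Not at h1
      exact (ih (by omega)).trans h1.2
  · intro i j hi hij hj
    have hdesc : ∀ k, Nat.find hex ≤ k → k < n → f (k + 1) ≤ f k := by
      intro k hk
      induction k, hk using Nat.le_induction with
      | base =>
        intro h
        exact ((Nat.find_spec hex).resolve_left h.ne).le
      | succ k hk ih =>
        intro h
        exact hstep k (by omega) (ih (by omega))
    induction j, hij using Nat.le_induction with
    | base => exact le_rfl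
    | succ j hij ih => exact (hdesc j (by omega) (by omega)).trans (ih (by omega))

namespace IsGeometric

variable {b : L → ℝ}

theorem pos_of_recursion (hg : IsGeometric rk w) (hb0 : b (⊥ : L) = 1)
    (hb : ∀ F : L, ⊥ < F → w F * b F = ∑ H : L with H ⋖ F, (w F - w H) * b H) (F : L) :
    0 < b F := by
  have hw := hg.strictMono
  induction F using WellFoundedLT.induction with
  | ind F ih =>
    rcases (bot_le (a := F)).eq_or_lt with rfl | hF
    · rw [hb0]; exact one_pos
    have h1 : 0 < w F := hg.weight_bot ▸ hw hF
    refine pos_of_mul_pos_right ?_ h1.le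
    rw [hb F hF]
    refine Finset.sum_pos (fun H hH => ?_) ?_
    · have h2 := (Finset.mem_filter.1 hH).2.lt
      exact mul_pos (sub_pos.2 (hw h2)) (ih H h2)
    · obtain ⟨H, hH⟩ := (Finset.univ.filter (· < F)).exists_maximal ⟨⊥, by simpa using hF⟩
      have h2 := (Finset.mem_filter.1 hH.1).2
      refine ⟨H, Finset.mem_filter.2 ⟨Finset.mem_univ _, h2, fun K h3 h4 => ?_⟩⟩
      exact h3.not_ge (hH.2 (Finset.mem_filter.2 ⟨Finset.mem_univ _, h4⟩) h3.le)

theorem exists_rk_eq (hg : IsGeometric rk w) {k : ℕ} (hk : k ≤ rk (⊤ : L)) :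
    ∃ F, rk F = k := by
  induction k with
  | zero => exact ⟨⊥, hg.rk_bot⟩
  | succ k ih =>
    obtain ⟨F, hF⟩ := ih (by omega)
    obtain ⟨G, hG, -⟩ := exists_covBy_le (A := F) (B := ⊤)
      (lt_top_iff_ne_top.2 fun h => by subst h; omega)
    exact ⟨G, by rw [hg.rk_covBy _ _ hG, hF]⟩

theorem sum_rk_eq (hg : IsGeometric rk w) (htop : 0 < rk (⊤ : L))
    (hb : ∀ F : L, ⊥ < F → w F * b F = ∑ H : L with H ⋖ F, (w F - w H) * b H) (k : ℕ) :
    ∑ F : L with rk F = k, b F = ∑ F : L with rk F = k, w F / w (⊤ : L) * b F +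
      ∑ F : L with rk F = k + 1, w F / w (⊤ : L) * b F := by
  have hwt : 0 < w (⊤ : L) := hg.weight_bot ▸ hg.strictMono (bot_lt_iff_ne_bot.2 fun h => by
    have := hg.rk_bot
    rw [← h] at this
    omega)
  have h1 : ∑ F : L with rk F = k + 1, w F / w (⊤ : L) * b F =
      ∑ H : L with rk H = k, ∑ F : L with H ⋖ F, (w F - w H) / w (⊤ : L) * b H := by
    rw [Finset.sum_comm' (t' := Finset.univ.filter fun F : L => rk F = k + 1)
      (s' := fun F => Finset.univ.filter fun H : L => H ⋖ F)]
    · refine Finset.sum_congr rfl fun F hF => ?_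
      have hF0 : ⊥ < F := bot_lt_iff_ne_bot.2 fun h => by
        have h2 := (Finset.mem_filter.1 hF).2
        subst h
        rw [hg.rk_bot] at h2
        omega
      rw [div_mul_eq_mul_div, hb F hF0, Finset.sum_div]
      exact Finset.sum_congr rfl fun H _ => by ring
    · intro H F
      simp only [Finset.mem_filter, Finset.mem_univ, true_and]
      constructor
      · rintro ⟨h2, h3⟩
        exact ⟨h3, by rw [hg.rk_covBy _ _ h3, h2]⟩
      · rintro ⟨h2, h3⟩
        have := hg.rk_covBy _ _ h2
        exact ⟨by omega, h2⟩
  rw [h1, ← Finset.sum_add_distrib]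
  refine Finset.sum_congr rfl fun H _ => ?_
  have h2 : ∑ F : L with H ⋖ F, (w F - w H) = w (⊤ : L) - w H := by
    rcases (le_top (a := H)).eq_or_lt with rfl | h
    · rw [Finset.sum_eq_zero, sub_self]
      intro F hF
      exact absurd (Finset.mem_filter.1 hF).2.lt not_top_lt
    · rw [← hg.sum_covBy _ _ h]
      simp only [le_top, and_true]
  rw [← Finset.sum_mul, ← Finset.sum_div, h2]
  field_simp
  ring

/-- The rank sums of a solution of the recursion are unimodal. -/
theorem exists_unimodal_index (hg : IsGeometric rk w) (htop : 0 < rk (⊤ : L))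
    (hb0 : b (⊥ : L) = 1)
    (hb : ∀ F : L, ⊥ < F → w F * b F = ∑ H : L with H ⋖ F, (w F - w H) * b H) {f : ℕ → ℝ}
    (hf : ∀ k ≤ rk (⊤ : L), f k = ∑ F : L with rk F = k, b F) :
    ∃ k₀ ≤ rk (⊤ : L), (∀ i j : ℕ, i ≤ j → j ≤ k₀ → f i ≤ f j) ∧
      (∀ i j : ℕ, k₀ ≤ i → i ≤ j → j ≤ rk (⊤ : L) → f j ≤ f i) := by
  have hw := hg.strictMono
  have hpos : ∀ F : L, 0 < rk F → 0 < w F := fun F hF => hg.weight_bot ▸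
    hw (bot_lt_iff_ne_bot.2 fun h => by
      subst h
      rw [hg.rk_bot] at hF
      omega)
  refine FlagDegree.exists_unimodal_index
    (g := fun k => ∑ F : L with rk F = k, w F / w (⊤ : L) * b F) (fun k hk hkn => ?_) ?_
    (hg.logConcave hb0 hb) fun k hk => by rw [hf k hk, hg.sum_rk_eq htop hb]
  · obtain ⟨F, hF⟩ := hg.exists_rk_eq hkn
    refine Finset.sum_pos (fun G hG => ?_) ⟨F, by simpa using hF⟩
    have h1 := (Finset.mem_filter.1 hG).2
    exact mul_pos (div_pos (hpos G (by omega)) (hpos ⊤ htop)) (hg.pos_of_recursion hb0 hb G)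
  · refine Finset.sum_eq_zero fun F hF => ?_
    have h1 : (⊥ : L) = F :=
      hg.eq_of_le bot_le (by rw [(Finset.mem_filter.1 hF).2]; exact Nat.zero_le _)
    rw [← h1, hg.weight_bot, zero_div, zero_mul]

end IsGeometric

end Flags

section MatroidFlats

open scoped Classical

variable {α : Type*} {M : Matroid α}

/-- The poset of flats of a matroid. -/
abbrev Flats (M : Matroid α) : Type _ := {F : Set α // M.IsFlat F}

namespace Flats

noncomputable instance [Fintype α] : Fintype (Flats M) := Fintype.ofFinite _

noncomputable instance : BoundedOrder (Flats M) where
  top := ⟨M.E, M.ground_isFlat⟩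
  le_top F := F.2.subset_ground
  bot := ⟨M.closure ∅, M.isFlat_closure ∅⟩
  bot_le F := (M.closure_subset_closure (Set.empty_subset F.1)).trans F.2.closure.subset

/-- The closure of a set, as a flat. -/
def span (M : Matroid α) (X : Set α) : Flats M := ⟨M.closure X, M.isFlat_closure X⟩

lemma span_le {X : Set α} {F : Flats M} (h : X ⊆ F.1) : span M X ≤ F :=
  (M.closure_subset_closure h).trans F.2.closure.subset

lemma subset_span (hE : M.E = Set.univ) (X : Set α) : X ⊆ (span M X).1 :=
  M.subset_closure X (hE ▸ Set.subset_univ X)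

lemma span_coe (F : Flats M) : span M F.1 = F := Subtype.ext F.2.closure

lemma span_insert_span (e : α) (X : Set α) :
    span M (insert e (span M X).1) = span M (insert e X) :=
  Subtype.ext (M.closure_insert_closure_eq_closure_insert e X)

lemma span_insert_of_mem {e : α} {X : Set α} (he : e ∈ (span M X).1) :
    span M (insert e X) = span M X :=
  Subtype.ext (Matroid.closure_insert_eq_of_mem_closure he)

lemma span_insert_congr {A : Flats M} {e f : α}
    (hf : f ∈ (span M (insert e A.1)).1) (hfA : f ∉ A.1) :
    span M (insert f A.1) = span M (insert e A.1) := by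
  refine Subtype.ext (Matroid.closure_insert_congr ⟨hf, ?_⟩)
  rwa [A.2.closure]

lemma exists_mem_notMem_of_lt {A B : Flats M} (h : A < B) : ∃ e ∈ B.1, e ∉ A.1 :=
  Set.not_subset.1 h.not_ge

lemma lt_span_insert (hE : M.E = Set.univ) {A : Flats M} {e : α} (he : e ∉ A.1) :
    A < span M (insert e A.1) := by
  have h := subset_span hE (insert e A.1)
  exact lt_of_le_not_ge ((Set.subset_insert e A.1).trans h) fun h' =>
    he (h' (h (Set.mem_insert e A.1)))

lemma covBy_span_insert (hE : M.E = Set.univ) {A : Flats M} {e : α} (he : e ∉ A.1) :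
    A ⋖ span M (insert e A.1) := by
  refine ⟨lt_span_insert hE he, fun C hAC hC => ?_⟩
  obtain ⟨f, hfC, hfA⟩ := exists_mem_notMem_of_lt hAC
  rw [← span_insert_congr (hC.le hfC) hfA] at hC
  exact hC.not_ge (span_le (Set.insert_subset hfC hAC.le))

lemma span_insert_eq_of_covBy (hE : M.E = Set.univ) {A H : Flats M} {e : α} (h : A ⋖ H)
    (heH : e ∈ H.1) (heA : e ∉ A.1) : span M (insert e A.1) = H :=
  (h.eq_or_eq (lt_span_insert hE heA).le (span_le (Set.insert_subset heH h.le))).resolve_left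
    (lt_span_insert hE heA).ne'

variable [Fintype α]

lemma eRk_ne_top (X : Set α) : M.eRk X ≠ ⊤ :=
  ((M.eRk_le_encard X).trans_lt X.toFinite.encard_lt_top).ne

lemma matroidRank_eq (X : Set α) : matroidRank M X = (M.eRk X).toNat := by
  obtain ⟨I, hI⟩ := M.exists_isBasis' X
  refine IsGreatest.csSup_eq ⟨⟨I, hI.subset, hI.indep, ?_⟩, ?_⟩
  · rw [hI.eRk_eq_encard, Set.ncard]
  · rintro _ ⟨J, hJX, hJ, rfl⟩
    exact ENat.toNat_le_toNat (hJ.encard_le_eRk_of_subset hJX) (eRk_ne_top X)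

lemma matroidRank_mono {X Y : Set α} (h : X ⊆ Y) : matroidRank M X ≤ matroidRank M Y := by
  rw [matroidRank_eq, matroidRank_eq]
  exact ENat.toNat_le_toNat (M.eRk_mono h) (eRk_ne_top Y)

lemma matroidRank_span (X : Set α) : matroidRank M (span M X).1 = matroidRank M X := by
  rw [matroidRank_eq, matroidRank_eq]
  exact congrArg _ (M.eRk_closure_eq X)

lemma matroidRank_insert (hE : M.E = Set.univ) {A : Flats M} {e : α} (he : e ∉ A.1) :
    matroidRank M (insert e A.1) = matroidRank M A.1 + 1 := by
  rw [matroidRank_eq, matroidRank_eq, Matroid.eRk_insert_eq_add_one,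
    ENat.toNat_add (eRk_ne_top _) ENat.one_ne_top, ENat.toNat_one]
  exact ⟨hE ▸ Set.mem_univ e, by rwa [A.2.closure]⟩

lemma matroidRank_covBy (hE : M.E = Set.univ) {A B : Flats M} (h : A ⋖ B) :
    matroidRank M B.1 = matroidRank M A.1 + 1 := by
  obtain ⟨e, heB, heA⟩ := exists_mem_notMem_of_lt h.lt
  rw [← span_insert_eq_of_covBy hE h heB heA, matroidRank_span, matroidRank_insert hE heA]

lemma sum_ncard_sub_ncard (hE : M.E = Set.univ) (A B : Flats M) (h : A < B) :
    ∑ H : Flats M with A ⋖ H ∧ H ≤ B, ((H.1.ncard : ℝ) - A.1.ncard) =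
      B.1.ncard - A.1.ncard := by
  have key : ∀ H : Flats M, A ≤ H →
      ((H.1.ncard : ℝ) - A.1.ncard) = ((H.1 \ A.1).toFinset.card : ℝ) := fun H hH => by
    rw [← Set.ncard_eq_toFinset_card', ← Set.ncard_sdiff_add_ncard_of_subset hH]
    push_cast
    ring
  rw [key B h.le, Finset.sum_congr rfl fun H hH => key H (Finset.mem_filter.1 hH).2.1.le,
    ← Nat.cast_sum, Nat.cast_inj]
  rw [Finset.card_eq_sum_card_fiberwise (f := fun e => span M (insert e A.1))
    (t := {H : Flats M | A ⋖ H ∧ H ≤ B})]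
  · refine Finset.sum_congr rfl fun H hH => congrArg _ ?_
    obtain ⟨hAH, hHB⟩ := (Finset.mem_filter.1 hH).2
    ext e
    simp only [Set.mem_toFinset, Set.mem_sdiff, Finset.mem_filter]
    constructor
    · rintro ⟨heH, heA⟩
      exact ⟨⟨hHB heH, heA⟩, span_insert_eq_of_covBy hE hAH heH heA⟩
    · rintro ⟨⟨-, heA⟩, rfl⟩
      exact ⟨subset_span hE _ (Set.mem_insert e A.1), heA⟩
  · intro e he
    simp only [Set.coe_toFinset, Set.mem_sdiff] at he
    simp only [Finset.coe_filter, Finset.mem_univ, true_and, Set.mem_ofPred_eq]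
    exact ⟨covBy_span_insert hE he.2, span_le (Set.insert_subset he.1 h.le)⟩

theorem isGeometric (hE : M.E = Set.univ) (hl : M.closure ∅ = ∅) :
    IsGeometric (fun F : Flats M => matroidRank M F.1) (fun F => (F.1.ncard : ℝ)) where
  strictMono A B h := Nat.cast_lt.2 (Set.ncard_lt_ncard h)
  weight_bot := by
    change ((M.closure ∅).ncard : ℝ) = 0
    rw [hl, Set.ncard_empty, Nat.cast_zero]
  rk_bot := by
    change matroidRank M (M.closure ∅) = 0
    rw [hl, matroidRank_eq, M.eRk_empty, ENat.toNat_zero]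
  rk_covBy A B h := matroidRank_covBy hE h
  sum_covBy := sum_ncard_sub_ncard hE
  exists_join A F G hF hG hne := by
    obtain ⟨e, heF, heA⟩ := exists_mem_notMem_of_lt hF.lt
    obtain ⟨f, hfG, hfA⟩ := exists_mem_notMem_of_lt hG.lt
    have hF' := span_insert_eq_of_covBy hE hF heF heA
    have hG' := span_insert_eq_of_covBy hE hG hfG hfA
    have hfF : f ∉ F.1 := fun h => hne (by
      rw [← hG', span_insert_eq_of_covBy hE hF h hfA])
    have heG : e ∉ G.1 := fun h => hne (by
      rw [← hF', span_insert_eq_of_covBy hE hG h heA])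
    have hFG : span M (insert f F.1) = span M (insert e G.1) := by
      rw [← hF', ← hG', span_insert_span, span_insert_span, Set.insert_comm]
    refine ⟨span M (insert f F.1), covBy_span_insert hE hfF, ?_, fun B hFB hGB => ?_⟩
    · rw [hFG]
      exact covBy_span_insert hE heG
    · exact span_le (Set.insert_subset (hGB hfG) hFB)

/-- The signed count of the sets spanning a given flat. -/
noncomputable def mu (F : Flats M) : ℝ := ∑ S ∈ {S : Finset α | span M S = F}, (-1 : ℝ) ^ S.card

/-- Toggling membership of `i` cancels a signed sum over a family stable under it. -/
lemma sum_neg_one_pow_card_eq_zero {R β : Type*} [CommRing R] [Fintype β] (i : β)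
    (c : Finset β → R) (hc : ∀ S, c (insert i S) = c (S.erase i)) :
    ∑ S : Finset β, (-1 : R) ^ S.card * c S = 0 := by
  refine Finset.sum_involution (fun S _ => if i ∈ S then S.erase i else insert i S)
    ?_ ?_ (fun _ _ => Finset.mem_univ _) ?_
  · intro S _
    split_ifs with h
    · have h1 := hc S
      rw [Finset.insert_eq_of_mem h] at h1
      rw [← h1, ← Finset.card_erase_add_one h]
      ring
    · have h1 := hc S
      rw [Finset.erase_eq_of_notMem h] at h1
      rw [h1, Finset.card_insert_of_notMem h]
      ring
  · intro S _ _
    split_ifs with h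
    · exact fun h' => (h' ▸ Finset.notMem_erase i S) h
    · exact fun h' => h (h' ▸ Finset.mem_insert_self i S)
  · intro S _
    by_cases h : i ∈ S
    · simp [h, Finset.insert_erase]
    · simp [h]

lemma mu_add_sum (hE : M.E = Set.univ) {F : Flats M} {i : α} (hi : i ∈ F.1) :
    mu F + ∑ G : Flats M with G ⋖ F ∧ i ∉ G.1, mu G = 0 := by
  have h0 : ∑ S ∈ {S : Finset α | span M (insert i S : Set α) = F}, (-1 : ℝ) ^ S.card = 0 := by
    rw [Finset.sum_filter]
    refine (Finset.sum_congr rfl fun S _ => ?_).trans (sum_neg_one_pow_card_eq_zero (R := ℝ) i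
      (fun S => if span M (insert i S : Set α) = F then 1 else 0) fun S => by simp)
    simp
  rw [← h0, ← Finset.sum_fiberwise _ (fun S : Finset α => span M (S : Set α))]
  have h1 : ∀ G : Flats M,
      ∑ S ∈ (Finset.univ.filter fun S : Finset α => span M (insert i S : Set α) = F).filter
        (fun S : Finset α => span M (S : Set α) = G), (-1 : ℝ) ^ S.card =
          if span M (insert i G.1) = F then mu G else 0 := by
    intro G
    rw [mu]
    split_ifs with h
    · refine Finset.sum_congr ?_ fun _ _ => rfl
      ext S
      simp only [Finset.mem_filter, Finset.mem_univ, true_and, and_iff_right_iff_imp]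
      rintro rfl
      rwa [span_insert_span] at h
    · refine Finset.sum_eq_zero fun S hS => absurd ?_ h
      simp only [Finset.mem_filter, Finset.mem_univ, true_and] at hS
      rw [← hS.2, span_insert_span, hS.1]
  rw [Finset.sum_congr rfl fun G _ => h1 G, ← Finset.sum_filter]
  have h2 : (Finset.univ.filter fun G : Flats M => span M (insert i G.1) = F) =
      insert F (Finset.univ.filter fun G : Flats M => G ⋖ F ∧ i ∉ G.1) := by
    ext G
    simp only [Finset.mem_filter, Finset.mem_univ, true_and, Finset.mem_insert]
    constructor
    · rintro rfl
      by_cases h : i ∈ G.1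
      · left
        rw [Set.insert_eq_of_mem h, span_coe]
      · exact .inr ⟨covBy_span_insert hE h, h⟩
    · rintro (rfl | ⟨h, hiG⟩)
      · rw [Set.insert_eq_of_mem hi, span_coe]
      · exact span_insert_eq_of_covBy hE h hi hiG
  rw [h2, Finset.sum_insert]
  simp

lemma ncard_mul_mu (hE : M.E = Set.univ) (F : Flats M) :
    F.1.ncard * mu F = -∑ G : Flats M with G ⋖ F, ((F.1.ncard : ℝ) - G.1.ncard) * mu G := by
  have h1 : ∀ i ∈ F.1.toFinset, mu F = -∑ G : Flats M with G ⋖ F, if i ∉ G.1 then mu G else 0 := by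
    intro i hi
    rw [← Finset.sum_filter, Finset.filter_filter]
    exact eq_neg_of_add_eq_zero_left (mu_add_sum hE (Set.mem_toFinset.1 hi))
  have h2 := Finset.sum_congr (rfl : F.1.toFinset = F.1.toFinset) h1
  rw [Finset.sum_const, nsmul_eq_mul, ← Set.ncard_eq_toFinset_card'] at h2
  rw [h2, Finset.sum_neg_distrib, Finset.sum_comm]
  refine congrArg _ (Finset.sum_congr rfl fun G hG => ?_)
  have hGF : G ≤ F := (Finset.mem_filter.1 hG).2.le
  rw [← Finset.sum_filter, Finset.sum_const, nsmul_eq_mul]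
  congr 1
  have h3 : (F.1.toFinset.filter fun i => i ∉ G.1) = (F.1 \ G.1).toFinset := by
    ext i
    simp
  rw [h3, ← Set.ncard_eq_toFinset_card', ← Set.ncard_sdiff_add_ncard_of_subset hGF]
  push_cast
  ring

lemma mu_bot (hE : M.E = Set.univ) (hl : M.closure ∅ = ∅) : mu (⊥ : Flats M) = 1 := by
  have h : ({S : Finset α | span M S = ⊥} : Finset (Finset α)) = {∅} := by
    ext S
    simp only [Finset.mem_filter, Finset.mem_univ, true_and, Finset.mem_singleton]
    constructor
    · intro hS
      have h1 := subset_span hE (S : Set α)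
      rw [hS] at h1
      exact Finset.coe_eq_empty.1 (Set.subset_empty_iff.1 (h1.trans hl.subset))
    · rintro rfl
      rw [Finset.coe_empty]
      rfl
  rw [mu, h]
  simp

lemma sum_mu (k : ℕ) : ∑ F : Flats M with matroidRank M F.1 = k, mu F =
    ∑ S ∈ {S : Finset α | matroidRank M (S : Set α) = k}, (-1 : ℝ) ^ S.card := by
  rw [← Finset.sum_fiberwise _ (fun S : Finset α => span M (S : Set α)), Finset.sum_filter]
  refine Finset.sum_congr rfl fun F _ => ?_
  rw [mu]
  split_ifs with h
  · refine Finset.sum_congr ?_ fun _ _ => rfl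
    ext S
    simp only [Finset.mem_filter, Finset.mem_univ, true_and]
    refine ⟨fun hS => ⟨?_, hS⟩, fun hS => hS.2⟩
    rw [← matroidRank_span, hS, h]
  · symm
    refine Finset.sum_eq_zero fun S hS => absurd ?_ h
    simp only [Finset.mem_filter, Finset.mem_univ, true_and] at hS
    rw [← hS.2, matroidRank_span, hS.1]

end Flats

variable [Fintype α]

/-- The coefficients of the characteristic polynomial count subsets by rank, with sign. -/
lemma coeff_matroidCharPoly {r k : ℕ} (hrank : matroidRank M Set.univ = r + 1)
    (hk : k ≤ r + 1) : (matroidCharPoly M r).coeff (r + 1 - k) =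
      ∑ S ∈ {S : Finset α | matroidRank M (S : Set α) = k}, (-1 : ℤ) ^ S.card := by
  rw [matroidCharPoly, finsetSum_coeff, Finset.sum_filter]
  refine Finset.sum_congr rfl fun S _ => ?_
  have hS : matroidRank M (S : Set α) ≤ r + 1 :=
    hrank ▸ Flats.matroidRank_mono (Set.subset_univ _)
  have h1 : (-1 : ℤ[X]) ^ S.card = C ((-1) ^ S.card) := by simp
  rw [h1, coeff_C_mul_X_pow]
  exact if_congr (by omega) rfl rfl

lemma coeff_sum_C_mul_X_pow {r k : ℕ} (a : ℕ → ℤ) (hk : k ≤ r + 1) :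
    (∑ j ∈ Finset.range (r + 2), C (a j) * X ^ (r + 1 - j)).coeff (r + 1 - k) = a k := by
  rw [finsetSum_coeff, Finset.sum_eq_single_of_mem k (Finset.mem_range.2 (by omega)),
    coeff_C_mul_X_pow, if_pos rfl]
  intro j hj hjk
  have := Finset.mem_range.1 hj
  rw [coeff_C_mul_X_pow, if_neg (by omega)]

lemma matroidCharPoly_eq_zero_of_mem_closure_empty {r : ℕ} {e : α} (he : e ∈ M.closure ∅) :
    matroidCharPoly M r = 0 := by
  refine Flats.sum_neg_one_pow_card_eq_zero (R := ℤ[X]) e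
    (fun S => X ^ (r + 1 - matroidRank M ↑S)) fun S => ?_
  have h : matroidRank M ↑(insert e S) = matroidRank M ↑(S.erase e) := by
    rw [← Finset.insert_erase (Finset.mem_insert_self e S), Finset.erase_insert_eq_erase,
      Finset.coe_insert, ← Flats.matroidRank_span,
      Flats.span_insert_of_mem, Flats.matroidRank_span]
    exact M.closure_subset_closure (Set.empty_subset _) he
  simp only [h]

end MatroidFlats

end FlagDegree

/-- **Unimodality of the f-vector of the broken circuit complex.**
If `M` is a matroid of rank `r + 1` on a finite ground set and `f` is the f-vector of its
broken circuit complex, defined by `χ_M(q) = Σ_{k=0}^{r+1} (−1)^k f_k q^{r+1−k}`, then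
there is an index `k₀ ≤ r+1` with `f_0 ≤ … ≤ f_{k₀} ≥ … ≥ f_{r+1}`. -/
theorem fvector_brokenCircuit_unimodal {α : Type*} [Fintype α] (M : Matroid α)
    (hE : M.E = Set.univ) (r : ℕ) (hrank : matroidRank M Set.univ = r + 1)
    (f : ℕ → ℤ)
    (hf : matroidCharPoly M r =
      ∑ k ∈ Finset.range (r + 2), C ((-1) ^ k * f k) * X ^ (r + 1 - k)) :
    ∃ k₀ ≤ r + 1,
      (∀ i j : ℕ, i ≤ j → j ≤ k₀ → f i ≤ f j) ∧
      (∀ i j : ℕ, k₀ ≤ i → i ≤ j → j ≤ r + 1 → f j ≤ f i) := by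
  classical
  have hcoeff : ∀ k ≤ r + 1, (matroidCharPoly M r).coeff (r + 1 - k) = (-1) ^ k * f k :=
    fun k hk => by rw [hf, FlagDegree.coeff_sum_C_mul_X_pow _ hk]
  rcases Set.eq_empty_or_nonempty (M.closure ∅) with hl | ⟨e, he⟩
  · have htop : matroidRank M (⊤ : FlagDegree.Flats M).1 = r + 1 := by
      rw [← hrank, ← hE]
      rfl
    have hg := FlagDegree.Flats.isGeometric hE hl
    obtain ⟨k₀, hk₀, h1, h2⟩ : ∃ k₀ ≤ matroidRank M (⊤ : FlagDegree.Flats M).1,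
        (∀ i j : ℕ, i ≤ j → j ≤ k₀ → (f i : ℝ) ≤ f j) ∧ (∀ i j : ℕ, k₀ ≤ i → i ≤ j →
          j ≤ matroidRank M (⊤ : FlagDegree.Flats M).1 → (f j : ℝ) ≤ f i) := by
      refine hg.exists_unimodal_index
        (b := fun F => (-1) ^ matroidRank M F.1 * FlagDegree.Flats.mu F) (f := fun k => (f k : ℝ))
        (htop ▸ Nat.succ_pos r) ?_ ?_ ?_
      · rw [hg.rk_bot, FlagDegree.Flats.mu_bot hE hl]
        norm_num
      · intro F _
        rw [mul_left_comm, FlagDegree.Flats.ncard_mul_mu hE, ← Finset.sum_neg_distrib,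
          Finset.mul_sum]
        refine Finset.sum_congr (by congr) fun H hH => ?_
        rw [FlagDegree.Flats.matroidRank_covBy hE (Finset.mem_filter.1 hH).2]
        ring
      · intro k hk
        have h3 := hcoeff k (htop ▸ hk)
        rw [FlagDegree.coeff_matroidCharPoly hrank (htop ▸ hk)] at h3
        have h4 := congrArg (Int.cast : ℤ → ℝ) h3
        push_cast at h4
        rw [← FlagDegree.Flats.sum_mu] at h4
        have h5 : (f k : ℝ) = (-1) ^ k * ((-1) ^ k * f k) := by
          rw [← mul_assoc, ← mul_pow]
          norm_num
        rw [h5, ← h4, Finset.mul_sum]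
        refine Finset.sum_congr (by congr) fun F hF => ?_
        rw [(Finset.mem_filter.1 hF).2]
    rw [htop] at hk₀ h2
    exact ⟨k₀, hk₀, fun i j hij hj => by exact_mod_cast h1 i j hij hj,
      fun i j hi hij hj => by exact_mod_cast h2 i j hi hij hj⟩
  · have h0 : ∀ k ≤ r + 1, f k = 0 := fun k hk => by
      have h1 := hcoeff k hk
      rw [FlagDegree.matroidCharPoly_eq_zero_of_mem_closure_empty he, coeff_zero] at h1
      exact (mul_eq_zero.1 h1.symm).resolve_left (pow_ne_zero _ (by norm_num))
    refine ⟨0, Nat.zero_le _, fun i j hij hj => ?_, fun i j _ hij hj => ?_⟩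
    · rw [Nat.le_zero.1 hj, Nat.le_zero.1 (hij.trans hj)]
    · rw [h0 i (hij.trans hj), h0 j hj]
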